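/- Let U(t)v₀(x) = ∫ e^{i(tξ³ + xξ)} v̂₀(ξ) dξ denote the Airy evolution group. Then ‖∫_{-∞}^{∞} U(t−t') f(·,t') dt'‖_{L⁸(ℝ²)} ≤ c ‖f‖_{L^{8/7}(ℝ²)} for all Schwartz functions f on ℝ². -/

import Mathlib

open MeasureTheory

/-- The Fourier transform in the paper's convention `v̂(ξ) = ∫ e^{-iξy} v(y) dy`. -/
noncomputable def fhat (v : ℝ → ℂ) (ξ : ℝ) : ℂ :=
  ∫ y : ℝ, Complex.exp (-(Complex.I * ξ * y)) * v y

/-- The Airy evolution group `U(t)v₀(x) = ∫ e^{i(tξ³+xξ)} v̂₀(ξ) dξ`. -/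
noncomputable def U (t : ℝ) (v : ℝ → ℂ) (x : ℝ) : ℂ :=
  ∫ ξ : ℝ, Complex.exp (Complex.I * ((t * ξ ^ 3 + x * ξ : ℝ) : ℂ)) * fhat v ξ

/-- The oscillatory exponential with cubic phase `tξ³ + xξ`. -/
noncomputable def airyExp (t x ξ : ℝ) : ℂ := Complex.exp (Complex.I * ((t * ξ ^ 3 + x * ξ : ℝ) : ℂ))

lemma norm_airyExp (t x ξ : ℝ) : ‖airyExp t x ξ‖ = 1 := by
  rw [airyExp, mul_comm, Complex.norm_exp_ofReal_mul_I]

lemma continuous_airyExp : Continuous fun v : (ℝ × ℝ) × ℝ => airyExp v.1.1 v.1.2 v.2 := by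
  unfold airyExp; fun_prop

lemma continuous_airyExp_right (t x : ℝ) : Continuous (airyExp t x) := by
  unfold airyExp; fun_prop

lemma airyExp_conj (t x ξ : ℝ) : starRingEnd ℂ (airyExp t x ξ) = airyExp (-t) (-x) ξ := by
  simp only [airyExp, ← Complex.exp_conj, map_mul, Complex.conj_I, Complex.conj_ofReal]
  push_cast; ring_nf

lemma airyExp_neg (t x ξ : ℝ) : airyExp t x (-ξ) = airyExp (-t) (-x) ξ := by
  simp only [airyExp]; congr 2; push_cast; ring

/-- Van der Corput bound for the phase `η³ + xη` away from its inflection point. -/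
lemma norm_integral_airyExp_one_le_of_one_le (x R : ℝ) (hR : 1 ≤ R) :
    ‖∫ η in (1:ℝ)..R, airyExp 1 x η‖ ≤ 5 := by
  set d : ℝ → ℝ := fun η => 3 * η ^ 2 + x with hd
  have hpos : ∀ η, 0 < 1 + d η ^ 2 := fun η => by positivity
  have hdd : ∀ η, HasDerivAt d (6 * η) η := fun η => by
    have := ((hasDerivAt_pow 2 η).const_mul 3).add_const x
    refine this.congr_deriv ?_
    norm_num; ring
  set a : ℝ → ℝ := fun η => d η / (1 + d η ^ 2) with ha
  set a' : ℝ → ℝ := fun η => 6 * η * (1 - d η ^ 2) / (1 + d η ^ 2) ^ 2 with ha'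
  have hda : ∀ η, HasDerivAt a (a' η) η := fun η => by
    have := (hdd η).div (((hdd η).pow 2).const_add 1) (hpos η).ne'
    refine this.congr_deriv ?_
    simp only [ha', Pi.pow_apply]
    congr 1
    norm_num; ring
  have hde : ∀ η, HasDerivAt (airyExp 1 x) (airyExp 1 x η * (Complex.I * d η)) η := fun η => by
    have h1 : HasDerivAt (fun ξ : ℝ => 1 * ξ ^ 3 + x * ξ) (d η) η := by
      have := (((hasDerivAt_pow 3 η).const_mul 1).add ((hasDerivAt_id η).const_mul x))
      refine this.congr_deriv ?_
      simp [hd]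
    exact ((h1.ofReal_comp).const_mul Complex.I).cexp
  have hdc : Continuous d := by fun_prop
  have hec := continuous_airyExp_right 1 x
  have hac : Continuous a := by
    simp only [ha]; exact hdc.div (by fun_prop) fun η => (hpos η).ne'
  have ha'c : Continuous a' := by
    simp only [ha']; exact Continuous.div (by fun_prop) (by fun_prop) fun η => (pow_pos (hpos η) 2).ne'
  have hG : ∀ η, HasDerivAt (fun η => airyExp 1 x η * (a η : ℂ))
      (airyExp 1 x η * (Complex.I * d η) * a η + airyExp 1 x η * a' η) η :=
    fun η => (hde η).mul (hda η).ofReal_comp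
  set r : ℝ → ℂ := fun η => airyExp 1 x η * (Complex.I * ((1 / (1 + d η ^ 2) : ℝ) : ℂ) - a' η) with hr
  have hrc : Continuous r := by
    have : Continuous fun η => 1 / (1 + d η ^ 2) :=
      continuous_const.div (by fun_prop) fun η => (hpos η).ne'
    simp only [hr]; fun_prop
  have hsplit : ∀ η, Complex.I * airyExp 1 x η =
      (airyExp 1 x η * (Complex.I * d η) * a η + airyExp 1 x η * a' η) + r η := fun η => by
    have h2 : d η * a η + 1 / (1 + d η ^ 2) = 1 := by
      simp only [ha]; field_simp [(hpos η).ne']; ring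
    have h3 : (d η : ℂ) * a η + ((1 / (1 + d η ^ 2) : ℝ) : ℂ) = 1 := by exact_mod_cast h2
    simp only [hr]
    linear_combination (-(Complex.I * airyExp 1 x η)) * h3
  have hInt : ∫ η in (1:ℝ)..R, Complex.I * airyExp 1 x η =
      (airyExp 1 x R * (a R : ℂ) - airyExp 1 x 1 * (a 1 : ℂ)) + ∫ η in (1:ℝ)..R, r η := by
    simp_rw [hsplit]
    have hcc : Continuous fun η => airyExp 1 x η * (Complex.I * d η) * a η + airyExp 1 x η * a' η := by
      fun_prop
    rw [intervalIntegral.integral_add (hcc.intervalIntegrable _ _) (hrc.intervalIntegrable _ _)]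
    congr 1
    exact intervalIntegral.integral_eq_sub_of_hasDerivAt (fun η _ => hG η) (hcc.intervalIntegrable _ _)
  have hrb : ‖∫ η in (1:ℝ)..R, r η‖ ≤ 7 / 6 * (Real.arctan (d R) - Real.arctan (d 1)) := by
    have hat : ∀ η, HasDerivAt (fun η => 7 / 6 * Real.arctan (d η))
        (7 / 6 * (1 / (1 + d η ^ 2) * (6 * η))) η := fun η => ((hdd η).arctan).const_mul _
    have hcont : Continuous fun η => 7 / 6 * (1 / (1 + d η ^ 2) * (6 * η)) := by
      have : Continuous fun η => 1 / (1 + d η ^ 2) :=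
        continuous_const.div (by fun_prop) fun η => (hpos η).ne'
      fun_prop
    have h := intervalIntegral.integral_eq_sub_of_hasDerivAt (fun η _ => hat η)
      (hcont.intervalIntegrable 1 R)
    rw [mul_sub, ← h]
    refine intervalIntegral.norm_integral_le_of_norm_le hR ?_ (hcont.intervalIntegrable _ _)
    refine Filter.Eventually.of_forall fun η hη => ?_
    have hη1 : 1 < η := hη.1
    simp only [hr, norm_mul, norm_airyExp, one_mul]
    refine (norm_sub_le _ _).trans ?_
    rw [norm_mul, Complex.norm_I, one_mul, Complex.norm_real, Complex.norm_real, Real.norm_eq_abs,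
      Real.norm_eq_abs, abs_of_pos (by have := hpos η; positivity)]
    have h1 : |a' η| ≤ 6 * η / (1 + d η ^ 2) := by
      simp only [ha']
      rw [abs_div, abs_of_pos (pow_pos (hpos η) 2), abs_mul, abs_of_pos (by linarith : 0 < 6 * η),
        div_le_div_iff₀ (pow_pos (hpos η) 2) (hpos η)]
      have : |1 - d η ^ 2| ≤ 1 + d η ^ 2 := by
        rw [abs_le]; constructor <;> nlinarith [sq_nonneg (d η)]
      have h6 : 0 ≤ 6 * η * (1 + d η ^ 2) := by have := hpos η; positivity
      nlinarith [mul_le_mul_of_nonneg_left this h6]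
    calc _ ≤ 1 / (1 + d η ^ 2) + 6 * η / (1 + d η ^ 2) := by gcongr
      _ ≤ η / (1 + d η ^ 2) + 6 * η / (1 + d η ^ 2) := by
          gcongr
      _ = _ := by ring
  have hab : ∀ η, |a η| ≤ 1 / 2 := fun η => by
    simp only [ha]
    rw [abs_div, abs_of_pos (hpos η), div_le_iff₀ (hpos η)]
    nlinarith [sq_nonneg (|d η| - 1), sq_abs (d η)]
  have hfin : ‖∫ η in (1:ℝ)..R, airyExp 1 x η‖ = ‖∫ η in (1:ℝ)..R, Complex.I * airyExp 1 x η‖ := by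
    rw [intervalIntegral.integral_const_mul, norm_mul, Complex.norm_I, one_mul]
  rw [hfin, hInt]
  refine (norm_add_le _ _).trans ?_
  have h1 : ‖airyExp 1 x R * (a R : ℂ) - airyExp 1 x 1 * (a 1 : ℂ)‖ ≤ 1 := by
    refine (norm_sub_le _ _).trans ?_
    simp only [norm_mul, norm_airyExp, one_mul, Complex.norm_real, Real.norm_eq_abs]
    linarith [hab R, hab 1]
  have := Real.arctan_lt_pi_div_two (d R)
  have := Real.neg_pi_div_two_lt_arctan (d 1)
  have := Real.pi_lt_d2
  linarith

lemma norm_integral_airyExp_one_le (x R : ℝ) (hR : 0 ≤ R) :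
    ‖∫ η in (0:ℝ)..R, airyExp 1 x η‖ ≤ 6 := by
  have key : ∀ S : ℝ, 0 ≤ S → S ≤ 1 → ‖∫ η in (0:ℝ)..S, airyExp 1 x η‖ ≤ 1 := fun S h0 h1 => by
    refine (intervalIntegral.norm_integral_le_of_norm_le_const (C := 1)
      fun η _ => (norm_airyExp 1 x η).le).trans ?_
    rw [sub_zero, abs_of_nonneg h0]; linarith
  rcases le_total R 1 with h | h
  · linarith [key R hR h]
  · have hc := continuous_airyExp_right 1 x
    rw [← intervalIntegral.integral_add_adjacent_intervals (hc.intervalIntegrable 0 1)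
      (hc.intervalIntegrable 1 R)]
    refine (norm_add_le _ _).trans ?_
    linarith [key 1 zero_le_one le_rfl, norm_integral_airyExp_one_le_of_one_le x R h]

lemma norm_integral_airyExp_le_of_pos {t : ℝ} (ht : 0 < t) (x R : ℝ) (hR : 0 ≤ R) :
    ‖∫ ξ in (0:ℝ)..R, airyExp t x ξ‖ ≤ 6 * t ^ (-(1 / 3 : ℝ)) := by
  set c := t ^ (1 / 3 : ℝ) with hc
  have hc0 : 0 < c := by positivity
  have hc3 : c ^ 3 = t := by
    rw [hc, ← Real.rpow_natCast, ← Real.rpow_mul ht.le]; norm_num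
  have h : ∀ ξ, airyExp t x ξ = airyExp 1 (x / c) (c * ξ) := fun ξ => by
    simp only [airyExp]; congr 2; rw [← hc3]; push_cast
    have : (c : ℂ) ≠ 0 := by exact_mod_cast hc0.ne'
    field_simp
  simp_rw [h]
  rw [intervalIntegral.integral_comp_mul_left (fun η => airyExp 1 (x / c) η) hc0.ne', norm_smul, mul_zero,
    Real.rpow_neg ht.le, ← hc, Real.norm_eq_abs, abs_of_pos (inv_pos.2 hc0), mul_comm]
  gcongr
  exact norm_integral_airyExp_one_le _ _ (by positivity)

/-- The Airy kernel with frequencies truncated to `[-R, R]`. -/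
noncomputable def airyKernel (R t x : ℝ) : ℂ := ∫ ξ in (-R)..R, airyExp t x ξ

lemma norm_airyKernel_le (R t x : ℝ) (hR : 0 ≤ R) : ‖airyKernel R t x‖ ≤ 2 * R := by
  refine (intervalIntegral.norm_integral_le_of_norm_le_const (C := 1)
      fun η _ => (norm_airyExp t x η).le).trans ?_
  rw [abs_of_nonneg (by linarith)]; linarith

lemma continuous_airyKernel (R : ℝ) : Continuous fun v : ℝ × ℝ => airyKernel R v.1 v.2 :=
  intervalIntegral.continuous_parametric_intervalIntegral_of_continuous' continuous_airyExp _ _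

/-- The dispersive estimate, uniformly in the frequency truncation. -/
lemma norm_airyKernel_le_rpow {R t : ℝ} (ht : t ≠ 0) (x : ℝ) (hR : 0 ≤ R) :
    ‖airyKernel R t x‖ ≤ 12 * |t| ^ (-(1 / 3 : ℝ)) := by
  have half : ∀ s y : ℝ, s ≠ 0 → ‖∫ ξ in (0:ℝ)..R, airyExp s y ξ‖ ≤ 6 * |s| ^ (-(1 / 3 : ℝ)) := by
    intro s y hs
    rcases hs.lt_or_gt with h | h
    · have := norm_integral_airyExp_le_of_pos (neg_pos.2 h) (-y) R hR
      simp_rw [← airyExp_conj s y] at this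
      rw [intervalIntegral.intervalIntegral_conj, RCLike.norm_conj] at this
      rwa [abs_of_neg h]
    · rw [abs_of_pos h]; exact norm_integral_airyExp_le_of_pos h y R hR
  have hc := continuous_airyExp_right t x
  have hneg : ∫ ξ in (-R)..0, airyExp t x ξ = ∫ ξ in (0:ℝ)..R, airyExp (-t) (-x) ξ := by
    simp_rw [← airyExp_neg]
    rw [intervalIntegral.integral_comp_neg (airyExp t x), neg_zero]
  rw [airyKernel, ← intervalIntegral.integral_add_adjacent_intervals (hc.intervalIntegrable _ 0)
      (hc.intervalIntegrable 0 R), hneg]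
  refine (norm_add_le _ _).trans ?_
  have h1 := half t x ht
  have h2 := half (-t) (-x) (neg_ne_zero.2 ht)
  rw [abs_neg] at h2
  linarith

/-- A smooth profile with `φ(0) = 1` and vanishing integral. -/
noncomputable def phi (t : ℝ) : ℝ := (1 - t ^ 2) / (1 + t ^ 2) ^ 2

/-- A single dyadic piece of the partition of unity on `ℝ \ {0}`. -/
noncomputable def psi (t : ℝ) : ℝ := phi t - phi (2 * t)

/-- The (inverse) Fourier transform of `psi`. -/
noncomputable def eta (τ : ℝ) : ℝ :=
  (|τ| * Real.exp (-|τ|) - |τ| / 4 * Real.exp (-(|τ| / 2))) / 2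

/-- The dyadic scales `2^(j - N)`. -/
noncomputable def scale (N j : ℕ) : ℝ := 2 ^ j / 2 ^ N

lemma scale_pos (N j : ℕ) : 0 < scale N j := by unfold scale; positivity

lemma continuous_phi : Continuous phi := by
  unfold phi
  exact Continuous.div (by fun_prop) (by fun_prop) fun t => by positivity

lemma continuous_psi : Continuous psi := by
  unfold psi; exact continuous_phi.sub (continuous_phi.comp (by fun_prop))

lemma abs_phi_le_one (t : ℝ) : |phi t| ≤ 1 := by
  unfold phi
  rw [abs_div, abs_of_pos (by positivity : 0 < (1 + t ^ 2) ^ 2), div_le_one (by positivity), abs_le]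
  constructor <;> nlinarith [sq_nonneg t, sq_nonneg (t ^ 2)]

lemma abs_psi_le (t : ℝ) : |psi t| ≤ 15 * t ^ 2 / (1 + 4 * t ^ 2) ^ 2 := by
  have hs : 0 ≤ t ^ 2 := sq_nonneg t
  have h : psi t = t ^ 2 * (9 + 15 * t ^ 2 - 12 * (t ^ 2) ^ 2) /
      ((1 + t ^ 2) ^ 2 * (1 + 4 * t ^ 2) ^ 2) := by
    unfold psi phi
    have h1 : 1 + t ^ 2 ≠ 0 := by positivity
    have h2 : 1 + 4 * t ^ 2 ≠ 0 := by positivity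
    rw [mul_pow, show (2:ℝ) ^ 2 = 4 by norm_num]
    field_simp
    ring
  generalize t ^ 2 = s at *
  rw [h, abs_div, abs_of_pos (by positivity : 0 < (1 + s) ^ 2 * (1 + 4 * s) ^ 2), abs_mul,
    abs_of_nonneg hs, div_le_div_iff₀ (by positivity) (by positivity)]
  have h2 : |9 + 15 * s - 12 * s ^ 2| ≤ 15 * (1 + s) ^ 2 := by
    rw [abs_le]; constructor <;> nlinarith
  calc s * |9 + 15 * s - 12 * s ^ 2| * (1 + 4 * s) ^ 2
      ≤ s * (15 * (1 + s) ^ 2) * (1 + 4 * s) ^ 2 := by gcongr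
    _ = _ := by ring

lemma abs_eta_le (τ : ℝ) : |eta τ| ≤ 5 * (|τ| / ((1 + |τ|) * (2 + |τ|))) := by
  unfold eta
  generalize hx : |τ| = x
  have hx0 : 0 ≤ x := hx ▸ abs_nonneg τ
  have he : Real.exp (-(x / 2)) ≤ 8 / ((1 + x) * (2 + x)) := by
    rw [Real.exp_neg, inv_eq_one_div, div_le_div_iff₀ (Real.exp_pos _) (by positivity)]
    nlinarith [Real.quadratic_le_exp_of_nonneg (x := x / 2) (by positivity)]
  have he' : Real.exp (-x) ≤ Real.exp (-(x / 2)) := Real.exp_le_exp.2 (by linarith)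
  have h1 := mul_le_mul_of_nonneg_left he hx0
  have h2 := mul_le_mul_of_nonneg_left he' hx0
  have h3 : 0 ≤ x * Real.exp (-x) := by positivity
  have h4 : 0 ≤ x * Real.exp (-(x / 2)) := by positivity
  have h5 : x * (8 / ((1 + x) * (2 + x))) = 8 * (x / ((1 + x) * (2 + x))) := by ring
  rw [abs_le]
  constructor <;> linarith

lemma sum_dyadic_le_one {y : ℝ} (hy : 0 < y) (n : ℕ) :
    ∑ j ∈ Finset.range n, (2 ^ j * y) / ((1 + 2 ^ j * y) * (1 + 2 * (2 ^ j * y))) ≤ 1 := by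
  have h : ∀ j : ℕ, (2 ^ j * y) / ((1 + 2 ^ j * y) * (1 + 2 * (2 ^ j * y))) =
      (2 ^ (j + 1) * y) / (1 + 2 ^ (j + 1) * y) - (2 ^ j * y) / (1 + 2 ^ j * y) := fun j => by
    have h1 : 1 + 2 ^ j * y ≠ 0 := by positivity
    have h2 : 1 + 2 * (2 ^ j * y) ≠ 0 := by positivity
    rw [show (2:ℝ) ^ (j + 1) * y = 2 * (2 ^ j * y) by ring]
    rw [div_sub_div _ _ h2 h1, div_eq_div_iff (mul_ne_zero h1 h2) (mul_ne_zero h2 h1)]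
    ring
  simp_rw [h]
  rw [Finset.sum_range_sub (fun j : ℕ => (2 ^ j * y) / (1 + 2 ^ j * y))]
  have h1 : (2 ^ n * y) / (1 + 2 ^ n * y) ≤ 1 := by rw [div_le_one (by positivity)]; linarith
  have h2 : 0 ≤ (2 ^ 0 * y) / (1 + 2 ^ 0 * y) := by positivity
  linarith

lemma sum_psi_scale (N : ℕ) (t : ℝ) :
    ∑ j ∈ Finset.range (2 * N), psi (scale N j * t) = phi (t / 2 ^ N) - phi (2 ^ N * t) := by
  have h : ∀ j, psi (scale N j * t) = phi (scale N j * t) - phi (scale N (j + 1) * t) := fun j => by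
    unfold psi scale; congr 2; ring
  simp_rw [h]
  rw [Finset.sum_range_sub' (fun j => phi (scale N j * t))]
  have : (2:ℝ) ^ N ≠ 0 := by positivity
  unfold scale
  congr 2
  · field_simp
  · rw [two_mul, pow_add]; field_simp

lemma sum_abs_psi_scale_le (N n : ℕ) {t : ℝ} (ht : t ≠ 0) :
    ∑ j ∈ Finset.range n, scale N j ^ (-(1 / 3 : ℝ)) * |psi (scale N j * t)| * |t| ^ (-(1 / 3 : ℝ))
      ≤ 30 := by
  have ht' : 0 < |t| := abs_pos.2 ht
  have key : ∀ y : ℝ, 0 < y → y ^ (-(1 / 3 : ℝ)) * (15 * y ^ 2 / (1 + 4 * y ^ 2) ^ 2) ≤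
      30 * (y / ((1 + y) * (1 + 2 * y))) := by
    intro y hy
    have h1 : y ^ (-(1 / 3 : ℝ)) * y ≤ 1 + y := by
      rw [← Real.rpow_add_one hy.ne']
      rcases le_total y 1 with h | h
      · have := Real.rpow_le_one hy.le h (by norm_num : (0:ℝ) ≤ -(1 / 3) + 1)
        linarith
      · have := Real.rpow_le_rpow_of_exponent_le h (by norm_num : (-(1 / 3) + 1 : ℝ) ≤ 1)
        rw [Real.rpow_one] at this
        linarith
    have h2 : (1 + y) ^ 2 * (1 + 2 * y) ≤ 2 * (1 + 4 * y ^ 2) ^ 2 := by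
      nlinarith [sq_nonneg (2 * y - 1), sq_nonneg (y - 1), sq_nonneg (y * (y - 1)), sq_nonneg (y ^ 2),
        sq_nonneg y]
    calc y ^ (-(1 / 3 : ℝ)) * (15 * y ^ 2 / (1 + 4 * y ^ 2) ^ 2)
        = (y ^ (-(1 / 3 : ℝ)) * y) * (15 * y / (1 + 4 * y ^ 2) ^ 2) := by ring
      _ ≤ (1 + y) * (15 * y / (1 + 4 * y ^ 2) ^ 2) := by gcongr
      _ ≤ _ := by
        rw [mul_div_assoc', mul_div_assoc', div_le_div_iff₀ (by positivity) (by positivity)]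
        have := mul_le_mul_of_nonneg_left h2 (by positivity : 0 ≤ 15 * y)
        nlinarith
  have h : ∀ j ∈ Finset.range n,
      scale N j ^ (-(1 / 3 : ℝ)) * |psi (scale N j * t)| * |t| ^ (-(1 / 3 : ℝ)) ≤
      30 * ((2 ^ j * (|t| / 2 ^ N)) / ((1 + 2 ^ j * (|t| / 2 ^ N)) * (1 + 2 * (2 ^ j * (|t| / 2 ^ N))))) := by
    intro j _
    have hs := scale_pos N j
    have e : (2:ℝ) ^ j * (|t| / 2 ^ N) = scale N j * |t| := by unfold scale; ring
    rw [e]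
    refine le_trans ?_ (key _ (by positivity))
    rw [Real.mul_rpow hs.le ht'.le, mul_right_comm]
    gcongr
    have := abs_psi_le (scale N j * t)
    rwa [mul_pow, ← sq_abs t, ← mul_pow] at this
  refine (Finset.sum_le_sum h).trans ?_
  rw [← Finset.mul_sum]
  have := sum_dyadic_le_one (y := |t| / 2 ^ N) (by positivity) n
  linarith

lemma sum_abs_eta_scale_le (N n : ℕ) (τ : ℝ) :
    ∑ j ∈ Finset.range n, |eta (τ / scale N j)| ≤ 5 := by
  rcases eq_or_ne τ 0 with rfl | hτ
  · simp [eta]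
  have hτ' : 0 < |τ| := abs_pos.2 hτ
  have h : ∀ j ∈ Finset.range n, |eta (τ / scale N j)| ≤
      5 * ((2 ^ j * (|τ| * 2 ^ N)⁻¹) / ((1 + 2 ^ j * (|τ| * 2 ^ N)⁻¹) * (1 + 2 * (2 ^ j * (|τ| * 2 ^ N)⁻¹)))) := by
    intro j _
    have hs := scale_pos N j
    have e : (2:ℝ) ^ j * (|τ| * 2 ^ N)⁻¹ = (|τ / scale N j|)⁻¹ := by
      rw [abs_div, abs_of_pos hs]; unfold scale; field_simp
    rw [e]
    refine (abs_eta_le _).trans ?_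
    have hx : 0 < |τ / scale N j| := abs_pos.2 (div_ne_zero hτ hs.ne')
    generalize |τ / scale N j| = x at *
    apply le_of_eq
    field_simp
    ring
  refine (Finset.sum_le_sum h).trans ?_
  rw [← Finset.mul_sum]
  have := sum_dyadic_le_one (y := (|τ| * 2 ^ N)⁻¹) (by positivity) n
  linarith

lemma integrableOn_mul_exp_neg {m : ℝ} (hm : 0 < m) :
    IntegrableOn (fun τ : ℝ => τ * Real.exp (-(m * τ))) (Set.Ioi 0) := by
  have := integrableOn_rpow_mul_exp_neg_mul_rpow (s := 1) (p := 1) (by norm_num) (by norm_num) hm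
  simpa using this

lemma integrable_abs_mul_exp_neg {m : ℝ} (hm : 0 < m) :
    Integrable (fun τ : ℝ => |τ| * Real.exp (-(m * |τ|))) := by
  have hf : IntegrableOn (fun τ : ℝ => |τ| * Real.exp (-(m * |τ|))) (Set.Ioi 0) :=
    (integrableOn_mul_exp_neg hm).congr_fun
      (fun τ hτ => by simp only [abs_of_pos (Set.mem_Ioi.1 hτ)]) measurableSet_Ioi
  have hg : IntegrableOn (fun τ : ℝ => |τ| * Real.exp (-(m * |τ|))) (Set.Iic 0) := by
    have hm : MeasurableEmbedding fun x : ℝ => -x := (Homeomorph.neg ℝ).measurableEmbedding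
    rw [← Measure.map_neg_eq_self (volume : Measure ℝ), hm.integrableOn_map_iff]
    simpa [Function.comp_def, integrableOn_Ici_iff_integrableOn_Ioi] using hf
  rw [← integrableOn_univ, ← Set.Iic_union_Ioi (a := (0:ℝ))]
  exact hg.union hf

lemma integral_Ioi_mul_cexp {m : ℝ} (hm : 0 < m) (t : ℝ) :
    ∫ τ in Set.Ioi (0:ℝ), ((τ * Real.exp (-(m * τ)) : ℝ) : ℂ) * Complex.exp (Complex.I * ((τ * t : ℝ) : ℂ))
      = 1 / (m - t * Complex.I) ^ 2 := by
  set a : ℂ := m - t * Complex.I with ha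
  have ha0 : a ≠ 0 := fun h => by
    have := congrArg Complex.re h
    simp [ha] at this
    exact hm.ne' this
  have hre : ∀ τ : ℝ, ‖Complex.exp (-(a * τ))‖ = Real.exp (-(m * τ)) := fun τ => by
    rw [Complex.norm_exp]; simp [ha]
  have e : ∀ τ : ℝ, ((τ * Real.exp (-(m * τ)) : ℝ) : ℂ) * Complex.exp (Complex.I * ((τ * t : ℝ) : ℂ)) =
      τ * Complex.exp (-(a * τ)) := fun τ => by
    push_cast; rw [mul_assoc, ← Complex.exp_add]; congr 2; rw [ha]; ring
  simp_rw [e]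
  have hd : ∀ τ : ℝ, HasDerivAt (fun τ : ℝ => -(τ / a + 1 / a ^ 2) * Complex.exp (-(a * τ)))
      (τ * Complex.exp (-(a * τ))) τ := fun τ => by
    have h1 : HasDerivAt (fun τ : ℝ => (τ : ℂ)) 1 τ := Complex.ofRealCLM.hasDerivAt
    have h2 := ((h1.const_mul a).neg).cexp
    have h3 := (((h1.div_const a).add_const (1 / a ^ 2)).neg).mul h2
    refine h3.congr_deriv ?_
    simp only [Pi.neg_apply]
    field_simp
    ring
  rw [integral_Ioi_of_hasDerivAt_of_tendsto' (fun τ _ => hd τ) (m := 0)]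
  · simp
  · refine (integrableOn_mul_exp_neg hm).mono' (by fun_prop) ?_
    filter_upwards [ae_restrict_mem measurableSet_Ioi] with τ hτ
    rw [norm_mul, hre, Complex.norm_real, Real.norm_eq_abs, abs_of_pos hτ]
  · rw [tendsto_zero_iff_norm_tendsto_zero]
    have l1 : Filter.Tendsto (fun τ : ℝ => τ * Real.exp (-(m * τ))) Filter.atTop (nhds 0) := by
      simpa using tendsto_rpow_mul_exp_neg_mul_atTop_nhds_zero 1 m hm
    have l2 : Filter.Tendsto (fun τ : ℝ => Real.exp (-(m * τ))) Filter.atTop (nhds 0) := by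
      simpa using tendsto_rpow_mul_exp_neg_mul_atTop_nhds_zero 0 m hm
    have l3 := (l1.const_mul (1 / ‖a‖)).add (l2.const_mul (1 / ‖a‖ ^ 2))
    simp only [mul_zero, add_zero] at l3
    refine squeeze_zero' (Filter.Eventually.of_forall fun _ => norm_nonneg _) ?_ l3
    filter_upwards [Filter.eventually_ge_atTop 0] with τ hτ
    rw [norm_mul, hre, norm_neg]
    have : ‖(τ:ℂ) / a + 1 / a ^ 2‖ ≤ 1 / ‖a‖ * τ + 1 / ‖a‖ ^ 2 := by
      refine (norm_add_le _ _).trans (le_of_eq ?_)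
      simp only [norm_div, Complex.norm_real, Real.norm_eq_abs, abs_of_nonneg hτ, norm_one, norm_pow]
      ring
    calc _ ≤ (1 / ‖a‖ * τ + 1 / ‖a‖ ^ 2) * Real.exp (-(m * τ)) := by gcongr
      _ = _ := by ring

lemma integral_abs_mul_cexp {m : ℝ} (hm : 0 < m) (t : ℝ) :
    ∫ τ : ℝ, ((|τ| * Real.exp (-(m * |τ|)) : ℝ) : ℂ) * Complex.exp (Complex.I * ((τ * t : ℝ) : ℂ))
      = ((2 * (m ^ 2 - t ^ 2) / (m ^ 2 + t ^ 2) ^ 2 : ℝ) : ℂ) := by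
  have hInt : Integrable fun τ : ℝ =>
      ((|τ| * Real.exp (-(m * |τ|)) : ℝ) : ℂ) * Complex.exp (Complex.I * ((τ * t : ℝ) : ℂ)) := by
    refine (integrable_abs_mul_exp_neg hm).mono' (by fun_prop) (Filter.Eventually.of_forall fun τ => ?_)
    rw [norm_mul, mul_comm Complex.I, Complex.norm_exp_ofReal_mul_I, mul_one, Complex.norm_real,
      Real.norm_eq_abs, abs_of_nonneg (by positivity)]
  rw [← integral_add_compl (measurableSet_Ioi (a := (0:ℝ))) hInt, Set.compl_Ioi]
  have h1 : ∫ τ in Set.Ioi (0:ℝ), ((|τ| * Real.exp (-(m * |τ|)) : ℝ) : ℂ) *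
      Complex.exp (Complex.I * ((τ * t : ℝ) : ℂ)) = 1 / (m - t * Complex.I) ^ 2 := by
    rw [← integral_Ioi_mul_cexp hm t]
    refine setIntegral_congr_fun measurableSet_Ioi fun τ hτ => ?_
    simp only [abs_of_pos (Set.mem_Ioi.1 hτ)]
  have h2 : ∫ τ in Set.Iic (0:ℝ), ((|τ| * Real.exp (-(m * |τ|)) : ℝ) : ℂ) *
      Complex.exp (Complex.I * ((τ * t : ℝ) : ℂ)) = 1 / (m + t * Complex.I) ^ 2 := by
    have := integral_Ioi_mul_cexp hm (-t)
    rw [show (m:ℂ) - ((-t : ℝ) : ℂ) * Complex.I = m + t * Complex.I by push_cast; ring] at this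
    rw [← this, ← neg_zero (G := ℝ), ← integral_comp_neg_Ioi, neg_zero]
    refine setIntegral_congr_fun measurableSet_Ioi fun τ hτ => ?_
    simp only [abs_neg, abs_of_pos (Set.mem_Ioi.1 hτ)]
    simp
  rw [h1, h2]
  have hp : (0:ℝ) < m ^ 2 + t ^ 2 := by positivity
  have hpc : ((m:ℂ) ^ 2 + t ^ 2) ≠ 0 := by exact_mod_cast hp.ne'
  have hprod : ((m:ℂ) - t * Complex.I) * (m + t * Complex.I) = m ^ 2 + t ^ 2 := by
    linear_combination (-(t:ℂ) ^ 2) * Complex.I_sq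
  have hne := hprod ▸ hpc
  have n1 := left_ne_zero_of_mul hne
  have n2 := right_ne_zero_of_mul hne
  push_cast
  rw [div_add_div _ _ (pow_ne_zero 2 n1) (pow_ne_zero 2 n2), ← mul_pow, hprod]
  congr 1
  linear_combination (2 * (t:ℂ) ^ 2) * Complex.I_sq

lemma eta_div_eq {l : ℝ} (hl : 0 < l) (τ : ℝ) :
    eta (τ / l) = 1 / (2 * l) * (|τ| * Real.exp (-(1 / l * |τ|))) -
      1 / (8 * l) * (|τ| * Real.exp (-(1 / (2 * l) * |τ|))) := by
  unfold eta
  rw [abs_div, abs_of_pos hl, show |τ| / l / 2 = 1 / (2 * l) * |τ| by field_simp,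
    show |τ| / l = 1 / l * |τ| by field_simp]
  field_simp
  ring

lemma integrable_eta_div {l : ℝ} (hl : 0 < l) : Integrable fun τ => eta (τ / l) := by
  simp_rw [eta_div_eq hl]
  exact ((integrable_abs_mul_exp_neg (by positivity)).const_mul _).sub
    ((integrable_abs_mul_exp_neg (by positivity)).const_mul _)

lemma integral_eta_div {l : ℝ} (hl : 0 < l) (t : ℝ) :
    ∫ τ : ℝ, (eta (τ / l) : ℂ) * Complex.exp (Complex.I * ((τ * t : ℝ) : ℂ)) =
      ((l * psi (l * t) : ℝ) : ℂ) := by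
  have hI : ∀ m : ℝ, 0 < m → Integrable fun τ : ℝ =>
      ((|τ| * Real.exp (-(m * |τ|)) : ℝ) : ℂ) * Complex.exp (Complex.I * ((τ * t : ℝ) : ℂ)) :=
    fun m hm => by
    refine (integrable_abs_mul_exp_neg hm).mono' (by fun_prop) (Filter.Eventually.of_forall fun τ => ?_)
    rw [norm_mul, mul_comm Complex.I, Complex.norm_exp_ofReal_mul_I, mul_one, Complex.norm_real,
      Real.norm_eq_abs, abs_of_nonneg (by positivity)]
  have e : ∀ τ : ℝ, (eta (τ / l) : ℂ) * Complex.exp (Complex.I * ((τ * t : ℝ) : ℂ)) =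
      ((1 / (2 * l) : ℝ) : ℂ) * (((|τ| * Real.exp (-(1 / l * |τ|)) : ℝ) : ℂ) *
        Complex.exp (Complex.I * ((τ * t : ℝ) : ℂ))) -
      ((1 / (8 * l) : ℝ) : ℂ) * (((|τ| * Real.exp (-(1 / (2 * l) * |τ|)) : ℝ) : ℂ) *
        Complex.exp (Complex.I * ((τ * t : ℝ) : ℂ))) := fun τ => by
    rw [eta_div_eq hl, Complex.ofReal_sub, Complex.ofReal_mul (1 / (2 * l)), Complex.ofReal_mul (1 / (8 * l))]
    ring
  simp_rw [e]
  rw [integral_sub ((hI _ (by positivity)).const_mul _) ((hI _ (by positivity)).const_mul _),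
    integral_const_mul, integral_const_mul, integral_abs_mul_cexp (by positivity),
    integral_abs_mul_cexp (by positivity), ← Complex.ofReal_mul, ← Complex.ofReal_mul, ← Complex.ofReal_sub]
  congr 1
  unfold psi phi
  have h1 : 1 + (l * t) ^ 2 ≠ 0 := by positivity
  have h2 : 1 + (2 * (l * t)) ^ 2 ≠ 0 := by positivity
  have h3 : (1 / l) ^ 2 + t ^ 2 = (1 + (l * t) ^ 2) / l ^ 2 := by field_simp
  have h4 : (1 / (2 * l)) ^ 2 + t ^ 2 = (1 + (2 * (l * t)) ^ 2) / (4 * l ^ 2) := by field_simp; ring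
  rw [h3, h4]
  field_simp
  ring

/-- The character `p ↦ e^{i(ζ₁p₁ + ζ₂p₂)}` of the plane. -/
noncomputable def planeChar (ζ p : ℝ × ℝ) : ℂ :=
  Complex.exp (Complex.I * ((ζ.1 * p.1 + ζ.2 * p.2 : ℝ) : ℂ))

lemma norm_planeChar (ζ p : ℝ × ℝ) : ‖planeChar ζ p‖ = 1 := by
  rw [planeChar, mul_comm, Complex.norm_exp_ofReal_mul_I]

lemma continuous_planeChar : Continuous fun v : (ℝ × ℝ) × (ℝ × ℝ) => planeChar v.1 v.2 := by
  unfold planeChar; fun_prop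

lemma planeChar_sub (ζ p q : ℝ × ℝ) : planeChar ζ (p - q) = planeChar ζ p * planeChar (-ζ) q := by
  simp only [planeChar, ← Complex.exp_add, Prod.fst_sub, Prod.snd_sub, Prod.fst_neg, Prod.snd_neg]
  congr 1; push_cast; ring

lemma conj_planeChar (ζ p : ℝ × ℝ) : starRingEnd ℂ (planeChar ζ p) = planeChar (-ζ) p := by
  simp only [planeChar, ← Complex.exp_conj, map_mul, Complex.conj_I, Complex.conj_ofReal,
    Prod.fst_neg, Prod.snd_neg]
  congr 1; push_cast; ring

/-- The Fourier transform on the plane. -/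
noncomputable def planeFourier (f : ℝ × ℝ → ℂ) (ζ : ℝ × ℝ) : ℂ := ∫ p, f p * planeChar ζ p

lemma integrable_mul_of_norm_le_one {α : Type*} [MeasurableSpace α] {μ : Measure α} {f e : α → ℂ}
    (hf : Integrable f μ) (he : AEStronglyMeasurable e μ) (h : ∀ x, ‖e x‖ ≤ 1) :
    Integrable (fun x => f x * e x) μ :=
  hf.mul_bdd (c := 1) he (Filter.Eventually.of_forall h)

/-- Fubini for a superposition of bounded functions. -/
lemma integral_mul_integral_swap {α β : Type*} [MeasurableSpace α] [MeasurableSpace β]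
    {μ : Measure α} {ν : Measure β} [SFinite μ] [SFinite ν] {h : α → ℂ} {F : β → ℂ} {e : α → β → ℂ}
    (hh : Integrable h μ) (hF : Integrable F ν) (he : Measurable (Function.uncurry e))
    (he1 : ∀ a b, ‖e a b‖ ≤ 1) :
    ∫ b, F b * ∫ a, h a * e a b ∂μ ∂ν = ∫ a, h a * ∫ b, F b * e a b ∂ν ∂μ := by
  simp_rw [← integral_const_mul]
  have : Integrable (Function.uncurry fun a b => h a * F b * e a b) (μ.prod ν) :=
    integrable_mul_of_norm_le_one (hh.mul_prod hF) he.aestronglyMeasurable fun x => he1 x.1 x.2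
  rw [integral_integral_swap (f := fun a b => h a * (F b * e a b)) (by
    exact this.congr (Filter.Eventually.of_forall fun x => by simp only [Function.uncurry]; ring))]
  refine integral_congr_ae (Filter.Eventually.of_forall fun b =>
    integral_congr_ae (Filter.Eventually.of_forall fun a => ?_))
  simp only; ring

lemma planeFourier_eq_of_conj (f : ℝ × ℝ → ℂ) (ζ : ℝ × ℝ) :
    starRingEnd ℂ (planeFourier f ζ) = ∫ q, starRingEnd ℂ (f q) * planeChar (-ζ) q := by
  rw [planeFourier, ← integral_conj]
  simp_rw [map_mul, conj_planeChar]

lemma norm_planeFourier_le (f : ℝ × ℝ → ℂ) (ζ : ℝ × ℝ) : ‖planeFourier f ζ‖ ≤ ∫ p, ‖f p‖ := by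
  refine (norm_integral_le_integral_norm _).trans (le_of_eq ?_)
  simp_rw [norm_mul, norm_planeChar, mul_one]

lemma continuous_planeFourier {f : ℝ × ℝ → ℂ} (hf : Integrable f) : Continuous (planeFourier f) := by
  refine continuous_of_dominated (bound := fun p => ‖f p‖) (fun ζ => ?_) (fun ζ => ?_) hf.norm ?_
  · exact hf.1.mul (continuous_planeChar.comp (by fun_prop : Continuous fun p => (ζ, p))).aestronglyMeasurable
  · exact Filter.Eventually.of_forall fun p => by rw [norm_mul, norm_planeChar, mul_one]
  · exact Filter.Eventually.of_forall fun p =>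
      continuous_const.mul (continuous_planeChar.comp (by fun_prop : Continuous fun ζ => (ζ, p)))

/-- A Gaussian on the plane. -/
noncomputable def planeGauss (b : ℝ) (ζ : ℝ × ℝ) : ℝ :=
  Real.exp (-b * ζ.1 ^ 2) * Real.exp (-b * ζ.2 ^ 2)

lemma planeGauss_pos (b : ℝ) (ζ : ℝ × ℝ) : 0 < planeGauss b ζ := by unfold planeGauss; positivity

lemma continuous_planeGauss (b : ℝ) : Continuous (planeGauss b) := by unfold planeGauss; fun_prop

lemma integrable_planeGauss {b : ℝ} (hb : 0 < b) : Integrable (planeGauss b) :=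
  (integrable_exp_neg_mul_sq hb).mul_prod (integrable_exp_neg_mul_sq hb)

lemma integral_planeGauss {b : ℝ} (hb : 0 < b) : ∫ ζ, planeGauss b ζ = Real.pi / b := by
  unfold planeGauss
  rw [Measure.volume_eq_prod, integral_prod_mul (fun x => Real.exp (-b * x ^ 2)) (fun x => Real.exp (-b * x ^ 2)),
    integral_gaussian, Real.mul_self_sqrt (by positivity)]

lemma norm_integral_planeGauss_mul_planeChar {b : ℝ} (hb : 0 < b) (p : ℝ × ℝ) :
    ‖∫ ζ, (planeGauss b ζ : ℂ) * planeChar ζ p‖ = Real.pi / b * planeGauss (1 / (4 * b)) p := by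
  have e : ∀ ζ : ℝ × ℝ, (planeGauss b ζ : ℂ) * planeChar ζ p =
      (Complex.exp (Complex.I * p.1 * ζ.1) * Complex.exp (-b * ζ.1 ^ 2)) *
      (Complex.exp (Complex.I * p.2 * ζ.2) * Complex.exp (-b * ζ.2 ^ 2)) := fun ζ => by
    simp only [planeGauss, planeChar]
    push_cast
    simp only [← Complex.exp_add]
    congr 1; ring
  simp_rw [e]
  rw [Measure.volume_eq_prod, integral_prod_mul
    (fun x : ℝ => Complex.exp (Complex.I * p.1 * x) * Complex.exp (-b * x ^ 2))
    (fun x : ℝ => Complex.exp (Complex.I * p.2 * x) * Complex.exp (-b * x ^ 2)),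
    fourierIntegral_gaussian (by simpa using hb), fourierIntegral_gaussian (by simpa using hb)]
  have h1 : ‖((Real.pi : ℂ) / b) ^ (1 / 2 : ℂ)‖ * ‖((Real.pi : ℂ) / b) ^ (1 / 2 : ℂ)‖ = Real.pi / b := by
    rw [← Complex.ofReal_div, Complex.norm_cpow_eq_rpow_re_of_pos (by positivity),
      ← Real.rpow_add (by positivity)]
    norm_num
  have h2 : ∀ x : ℝ, ‖Complex.exp (-(x:ℂ) ^ 2 / (4 * b))‖ = Real.exp (-(1 / (4 * b)) * x ^ 2) := fun x => by
    rw [show -(x:ℂ) ^ 2 / (4 * b) = ((-(1 / (4 * b)) * x ^ 2 : ℝ) : ℂ) by push_cast; ring,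
      ← Complex.ofReal_exp, Complex.norm_real, Real.norm_eq_abs, abs_of_pos (Real.exp_pos _)]
  rw [norm_mul, norm_mul, norm_mul, h2, h2, planeGauss, ← h1]
  ring

/-- Schur's bound for a convolution form with nonnegative kernel. -/
lemma lintegral_mul_mul_sub_le {f : ℝ × ℝ → ENNReal} {G : ℝ × ℝ → ENNReal} (hf : Measurable f)
    (hG : Measurable G) :
    ∫⁻ w : (ℝ × ℝ) × (ℝ × ℝ), f w.1 * f w.2 * G (w.1 - w.2) ≤ (∫⁻ p, f p ^ 2) * ∫⁻ p, G p := by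
  have amgm : ∀ a b : ENNReal, a * b ≤ 2⁻¹ * (a ^ 2 + b ^ 2) := fun a b => by
    have := ENNReal.young_inequality a b Real.HolderConjugate.two_two
    rw [ENNReal.rpow_two, ENNReal.rpow_two, ENNReal.ofReal_ofNat] at this
    rwa [mul_add, mul_comm _ (a ^ 2), mul_comm _ (b ^ 2), ← div_eq_mul_inv, ← div_eq_mul_inv]
  have h1 : ∫⁻ w : (ℝ × ℝ) × (ℝ × ℝ), f w.1 ^ 2 * G (w.1 - w.2) = (∫⁻ p, f p ^ 2) * ∫⁻ p, G p := by
    rw [Measure.volume_eq_prod, lintegral_prod _ (by fun_prop)]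
    simp only
    have : ∀ p : ℝ × ℝ, ∫⁻ q : ℝ × ℝ, f p ^ 2 * G (p - q) = f p ^ 2 * ∫⁻ q, G q := fun p => by
      rw [lintegral_const_mul _ (by fun_prop), lintegral_sub_left_eq_self]
    simp_rw [this]
    rw [lintegral_mul_const _ (by fun_prop)]
  have h2 : ∫⁻ w : (ℝ × ℝ) × (ℝ × ℝ), f w.2 ^ 2 * G (w.1 - w.2) = (∫⁻ p, f p ^ 2) * ∫⁻ p, G p := by
    rw [Measure.volume_eq_prod, lintegral_prod_symm _ (by fun_prop)]
    simp only
    have : ∀ q : ℝ × ℝ, ∫⁻ p : ℝ × ℝ, f q ^ 2 * G (p - q) = f q ^ 2 * ∫⁻ p, G p := fun q => by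
      rw [lintegral_const_mul _ (by fun_prop), lintegral_sub_right_eq_self]
    simp_rw [this]
    rw [lintegral_mul_const _ (by fun_prop)]
  calc ∫⁻ w : (ℝ × ℝ) × (ℝ × ℝ), f w.1 * f w.2 * G (w.1 - w.2)
      ≤ ∫⁻ w : (ℝ × ℝ) × (ℝ × ℝ), 2⁻¹ * (f w.1 ^ 2 * G (w.1 - w.2) + f w.2 ^ 2 * G (w.1 - w.2)) := by
        refine lintegral_mono fun w => ?_
        rw [← add_mul, ← mul_assoc]
        exact mul_le_mul' (amgm _ _) le_rfl
    _ = _ := by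
        rw [lintegral_const_mul _ (by fun_prop), lintegral_add_left (by fun_prop), h1, h2, ← two_mul,
          ← mul_assoc, ENNReal.inv_mul_cancel (by norm_num) (by norm_num), one_mul]

/-- Bessel's inequality with Gaussian damping. -/
lemma lintegral_planeFourier_sq_mul_planeGauss_le {f : ℝ × ℝ → ℂ} (hfm : Measurable f)
    (hf : Integrable f) {b : ℝ} (hb : 0 < b) :
    ∫⁻ ζ, ‖planeFourier f ζ‖ₑ ^ 2 * ENNReal.ofReal (planeGauss b ζ) ≤
      ENNReal.ofReal (4 * Real.pi ^ 2) * ∫⁻ p, ‖f p‖ₑ ^ 2 := by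
  set C := ∫ p, ‖f p‖
  have hcf := continuous_planeFourier hf
  have hInt : Integrable fun ζ => planeGauss b ζ * ‖planeFourier f ζ‖ ^ 2 := by
    refine (integrable_planeGauss hb).mul_bdd (c := C ^ 2) (by fun_prop) (Filter.Eventually.of_forall fun ζ => ?_)
    rw [norm_pow, norm_norm]
    gcongr
    exact norm_planeFourier_le f ζ
  have h1 : ∫⁻ ζ, ‖planeFourier f ζ‖ₑ ^ 2 * ENNReal.ofReal (planeGauss b ζ) =
      ENNReal.ofReal (∫ ζ, planeGauss b ζ * ‖planeFourier f ζ‖ ^ 2) := by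
    rw [ofReal_integral_eq_lintegral_ofReal hInt
      (Filter.Eventually.of_forall fun ζ => mul_nonneg (planeGauss_pos b ζ).le (by positivity))]
    refine lintegral_congr fun ζ => ?_
    rw [ENNReal.ofReal_mul (planeGauss_pos b ζ).le, ENNReal.ofReal_pow (norm_nonneg _), ofReal_norm, mul_comm]
  have hconj : Integrable fun q => starRingEnd ℂ (f q) := by
    refine hf.norm.mono' (by fun_prop) (Filter.Eventually.of_forall fun q => by rw [RCLike.norm_conj])
  have h2 : ((∫ ζ, planeGauss b ζ * ‖planeFourier f ζ‖ ^ 2 : ℝ) : ℂ) =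
      ∫ w : (ℝ × ℝ) × (ℝ × ℝ), (f w.1 * starRingEnd ℂ (f w.2)) *
        ∫ ζ, (planeGauss b ζ : ℂ) * planeChar ζ (w.1 - w.2) := by
    rw [Measure.volume_eq_prod (ℝ × ℝ), integral_mul_integral_swap (μ := volume)
      (h := fun ζ => (planeGauss b ζ : ℂ)) (F := fun w : (ℝ × ℝ) × (ℝ × ℝ) => f w.1 * starRingEnd ℂ (f w.2))
      (e := fun ζ (w : (ℝ × ℝ) × (ℝ × ℝ)) => planeChar ζ (w.1 - w.2))
      (integrable_planeGauss hb).ofReal (hf.mul_prod hconj) ?_ fun ζ w => (norm_planeChar _ _).le]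
    · rw [← integral_complex_ofReal]
      refine integral_congr_ae (Filter.Eventually.of_forall fun ζ => ?_)
      simp only
      push_cast
      congr 1
      rw [← Complex.mul_conj', planeFourier_eq_of_conj, planeFourier, ← integral_prod_mul]
      refine integral_congr_ae (Filter.Eventually.of_forall fun w => ?_)
      simp only [planeChar_sub]
      ring
    · exact (continuous_planeChar.comp (by fun_prop : Continuous
        fun v : (ℝ × ℝ) × ((ℝ × ℝ) × (ℝ × ℝ)) => (v.1, v.2.1 - v.2.2))).measurable
  rw [h1]
  have h3 : ENNReal.ofReal (∫ ζ, planeGauss b ζ * ‖planeFourier f ζ‖ ^ 2) =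
      ‖((∫ ζ, planeGauss b ζ * ‖planeFourier f ζ‖ ^ 2 : ℝ) : ℂ)‖ₑ := by
    rw [← ofReal_norm, Complex.norm_real, Real.norm_eq_abs, abs_of_nonneg]
    exact integral_nonneg fun ζ => mul_nonneg (planeGauss_pos b ζ).le (by positivity)
  rw [h3, h2]
  refine (enorm_integral_le_lintegral_enorm _).trans ?_
  have h4 : ∀ w : (ℝ × ℝ) × (ℝ × ℝ), ‖(f w.1 * starRingEnd ℂ (f w.2)) *
        ∫ ζ, (planeGauss b ζ : ℂ) * planeChar ζ (w.1 - w.2)‖ₑ = ‖f w.1‖ₑ * ‖f w.2‖ₑ *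
      (fun r => ENNReal.ofReal (Real.pi / b * planeGauss (1 / (4 * b)) r)) (w.1 - w.2) := fun w => by
    have hc : ‖starRingEnd ℂ (f w.2)‖ₑ = ‖f w.2‖ₑ := by
      rw [← ofReal_norm, RCLike.norm_conj, ofReal_norm]
    simp only
    rw [enorm_mul, enorm_mul, hc, ← norm_integral_planeGauss_mul_planeChar hb, ofReal_norm]
  simp_rw [h4]
  have hg := continuous_planeGauss (1 / (4 * b))
  refine (lintegral_mul_mul_sub_le hfm.enorm (G := fun r => ENNReal.ofReal (Real.pi / b * planeGauss (1 / (4 * b)) r))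
    (by fun_prop)).trans (le_of_eq ?_)
  have hb' : 0 < 1 / (4 * b) := by positivity
  rw [← ofReal_integral_eq_lintegral_ofReal ((integrable_planeGauss hb').const_mul _)
    (Filter.Eventually.of_forall fun r => mul_nonneg (by positivity) (planeGauss_pos _ r).le),
    integral_const_mul, integral_planeGauss hb', mul_comm]
  congr 2
  field_simp

/-- Bessel's inequality for the Fourier transform on the plane. -/
lemma lintegral_planeFourier_sq_le {f : ℝ × ℝ → ℂ} (hfm : Measurable f) (hf : Integrable f) :
    ∫⁻ ζ, ‖planeFourier f ζ‖ₑ ^ 2 ≤ ENNReal.ofReal (4 * Real.pi ^ 2) * ∫⁻ p, ‖f p‖ₑ ^ 2 := by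
  have hcf := continuous_planeFourier hf
  have hlim : ∀ ζ, Filter.Tendsto (fun n : ℕ => ‖planeFourier f ζ‖ₑ ^ 2 *
      ENNReal.ofReal (planeGauss (1 / ((n:ℝ) + 1)) ζ)) Filter.atTop (nhds (‖planeFourier f ζ‖ₑ ^ 2)) := by
    intro ζ
    have hc : Continuous fun b => planeGauss b ζ := by unfold planeGauss; fun_prop
    have h := (hc.tendsto 0).comp tendsto_one_div_add_atTop_nhds_zero_nat
    have h0 : planeGauss 0 ζ = 1 := by simp [planeGauss]
    rw [h0] at h
    have h2 := ENNReal.Tendsto.const_mul (a := ‖planeFourier f ζ‖ₑ ^ 2) (ENNReal.tendsto_ofReal h)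
      (Or.inl (by simp))
    simpa using h2
  calc ∫⁻ ζ, ‖planeFourier f ζ‖ₑ ^ 2
      = ∫⁻ ζ, Filter.liminf (fun n : ℕ => ‖planeFourier f ζ‖ₑ ^ 2 *
      ENNReal.ofReal (planeGauss (1 / ((n:ℝ) + 1)) ζ)) Filter.atTop :=
        lintegral_congr fun ζ => (hlim ζ).liminf_eq.symm
    _ ≤ Filter.liminf (fun n : ℕ => ∫⁻ ζ, ‖planeFourier f ζ‖ₑ ^ 2 *
      ENNReal.ofReal (planeGauss (1 / ((n:ℝ) + 1)) ζ)) Filter.atTop := by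
        refine lintegral_liminf_le fun n => ?_
        have := continuous_planeGauss (1 / ((n:ℝ) + 1))
        fun_prop
    _ ≤ _ := by
        refine Filter.liminf_le_of_le (by isBoundedDefault) fun c hc => ?_
        obtain ⟨n, hn⟩ := hc.exists
        exact hn.trans (lintegral_planeFourier_sq_mul_planeGauss_le hfm hf (by positivity))

/-- The bilinear convolution form with kernel `K`. -/
noncomputable def convForm (K g f : ℝ × ℝ → ℂ) : ℂ :=
  ∫ w : (ℝ × ℝ) × (ℝ × ℝ), g w.1 * f w.2 * K (w.1 - w.2)

lemma norm_convForm_le {K g f : ℝ × ℝ → ℂ} {C : ℝ} (hK : ∀ p, ‖K p‖ ≤ C) (hg : Integrable g)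
    (hf : Integrable f) : ‖convForm K g f‖ ≤ C * ((∫ p, ‖g p‖) * ∫ p, ‖f p‖) := by
  rw [convForm, Measure.volume_eq_prod (ℝ × ℝ), ← integral_prod_mul, ← integral_const_mul]
  refine norm_integral_le_of_norm_le ((hg.norm.mul_prod hf.norm).const_mul C)
    (Filter.Eventually.of_forall fun w => ?_)
  rw [norm_mul, norm_mul, mul_comm C]
  exact mul_le_mul_of_nonneg_left (hK _) (by positivity)

/-- A weighted superposition of the dyadic pieces (in time) of the truncated Airy kernel. -/
noncomputable def dyadicKernel (N : ℕ) (R : ℝ) (c : ℕ → ℂ) (p : ℝ × ℝ) : ℂ :=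
  ∑ j ∈ Finset.range (2 * N), c j * ((psi (scale N j * p.2) : ℂ) * airyKernel R p.2 p.1)

lemma continuous_dyadicKernel (N : ℕ) (R : ℝ) (c : ℕ → ℂ) : Continuous (dyadicKernel N R c) := by
  unfold dyadicKernel
  have h1 := continuous_psi
  have h2 : Continuous fun p : ℝ × ℝ => airyKernel R p.2 p.1 :=
    (continuous_airyKernel R).comp continuous_swap
  fun_prop

/-- Bound for the kernel when the weights have size `scale ^ (-1/3)`. -/
lemma norm_dyadicKernel_le {N : ℕ} {R : ℝ} (hR : 0 ≤ R) {c : ℕ → ℂ}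
    (hc : ∀ j, ‖c j‖ ≤ scale N j ^ (-(1 / 3 : ℝ))) (p : ℝ × ℝ) : ‖dyadicKernel N R c p‖ ≤ 360 := by
  rcases eq_or_ne p.2 0 with h | h
  · simp [dyadicKernel, h, psi]
  calc ‖dyadicKernel N R c p‖
      ≤ ∑ j ∈ Finset.range (2 * N), ‖c j * ((psi (scale N j * p.2) : ℂ) * airyKernel R p.2 p.1)‖ :=
        norm_sum_le _ _
    _ ≤ ∑ j ∈ Finset.range (2 * N), 12 * (scale N j ^ (-(1 / 3 : ℝ)) * |psi (scale N j * p.2)| *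
          |p.2| ^ (-(1 / 3 : ℝ))) := by
        refine Finset.sum_le_sum fun j _ => ?_
        have h1 := norm_airyKernel_le_rpow h p.1 hR
        rw [norm_mul, norm_mul, Complex.norm_real, Real.norm_eq_abs]
        calc _ ≤ scale N j ^ (-(1 / 3 : ℝ)) * (|psi (scale N j * p.2)| * (12 * |p.2| ^ (-(1 / 3 : ℝ)))) := by
              have := scale_pos N j
              gcongr
              exact hc j
          _ = _ := by ring
    _ ≤ 360 := by
        rw [← Finset.mul_sum]
        linarith [sum_abs_psi_scale_le N (2 * N) h]

/-- The multiplier of `dyadicKernel` in the modulation variable. -/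
noncomputable def dyadicSymbol (N : ℕ) (c : ℕ → ℂ) (τ : ℝ) : ℂ :=
  ∑ j ∈ Finset.range (2 * N), c j / scale N j * (eta (τ / scale N j) : ℂ)

lemma integrable_dyadicSymbol (N : ℕ) (c : ℕ → ℂ) : Integrable (dyadicSymbol N c) := by
  unfold dyadicSymbol
  exact integrable_finsetSum _ fun j _ => ((integrable_eta_div (scale_pos N j)).ofReal).const_mul _

lemma norm_dyadicSymbol_le {N : ℕ} {c : ℕ → ℂ} (hc : ∀ j, ‖c j‖ ≤ scale N j) (τ : ℝ) :
    ‖dyadicSymbol N c τ‖ ≤ 5 := by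
  refine (norm_sum_le _ _).trans ((Finset.sum_le_sum fun j _ => ?_).trans
    (sum_abs_eta_scale_le N (2 * N) τ))
  have h := scale_pos N j
  rw [norm_mul, norm_div, Complex.norm_real, Complex.norm_real, Real.norm_eq_abs, Real.norm_eq_abs,
    abs_of_pos h]
  refine mul_le_of_le_one_left (abs_nonneg _) ?_
  rw [div_le_one h]
  exact hc j

/-- The shear straightening the curve `τ = ξ³`. -/
def cubicShear (a : ℝ × ℝ) : ℝ × ℝ := (a.1, a.2 + a.1 ^ 3)

lemma continuous_cubicShear : Continuous cubicShear := by unfold cubicShear; fun_prop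

lemma lintegral_cubicShear {h : ℝ × ℝ → ENNReal} (hh : Measurable h) :
    ∫⁻ a, h (cubicShear a) = ∫⁻ a, h a := by
  have := continuous_cubicShear.measurable
  rw [Measure.volume_eq_prod, lintegral_prod _ (by fun_prop), lintegral_prod _ (by fun_prop)]
  refine lintegral_congr fun x => ?_
  exact lintegral_add_right_eq_self (fun y => h (x, y)) (x ^ 3)

lemma dyadicKernel_eq_integral (N : ℕ) {R : ℝ} (hR : 0 ≤ R) (c : ℕ → ℂ) (p : ℝ × ℝ) :
    dyadicKernel N R c p = ∫ a : ℝ × ℝ, dyadicSymbol N c a.2 * planeChar (cubicShear a) p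
      ∂((volume.restrict (Set.Ioc (-R) R)).prod volume) := by
  have h : ∀ a : ℝ × ℝ, dyadicSymbol N c a.2 * planeChar (cubicShear a) p =
      airyExp p.2 p.1 a.1 * (dyadicSymbol N c a.2 * Complex.exp (Complex.I * ((a.2 * p.2 : ℝ) : ℂ))) := by
    intro a
    simp only [planeChar, airyExp, cubicShear]
    rw [mul_left_comm, ← Complex.exp_add]
    congr 2
    push_cast; ring
  simp_rw [h]
  rw [integral_prod_mul (airyExp p.2 p.1)
    (fun τ => dyadicSymbol N c τ * Complex.exp (Complex.I * ((τ * p.2 : ℝ) : ℂ)))]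
  have h1 : ∫ τ : ℝ, dyadicSymbol N c τ * Complex.exp (Complex.I * ((τ * p.2 : ℝ) : ℂ)) =
      ∑ j ∈ Finset.range (2 * N), c j * (psi (scale N j * p.2) : ℂ) := by
    simp_rw [dyadicSymbol, Finset.sum_mul, mul_assoc]
    rw [integral_finsetSum]
    · refine Finset.sum_congr rfl fun j _ => ?_
      rw [integral_const_mul, integral_eta_div (scale_pos N j)]
      have : (scale N j : ℂ) ≠ 0 := by exact_mod_cast (scale_pos N j).ne'
      push_cast
      field_simp
    · intro j _
      refine (integrable_mul_of_norm_le_one (integrable_eta_div (scale_pos N j)).ofReal ?_ ?_).const_mul _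
      · exact (by fun_prop : Continuous fun τ : ℝ =>
          Complex.exp (Complex.I * ((τ * p.2 : ℝ) : ℂ))).aestronglyMeasurable
      · intro τ
        rw [mul_comm, Complex.norm_exp_ofReal_mul_I]
  rw [h1, dyadicKernel, Finset.mul_sum, airyKernel, intervalIntegral.integral_of_le (by linarith)]
  exact Finset.sum_congr rfl fun j _ => by ring

lemma planeFourier_mul_planeFourier_neg (g f : ℝ × ℝ → ℂ) (ζ : ℝ × ℝ) :
    planeFourier g ζ * planeFourier f (-ζ) =
      ∫ w : (ℝ × ℝ) × (ℝ × ℝ), g w.1 * f w.2 * planeChar ζ (w.1 - w.2) := by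
  rw [planeFourier, planeFourier, ← integral_prod_mul]
  refine integral_congr_ae (Filter.Eventually.of_forall fun w => ?_)
  simp only [planeChar_sub]
  ring

lemma convForm_dyadicKernel (N : ℕ) {R : ℝ} (hR : 0 ≤ R) (c : ℕ → ℂ) {g f : ℝ × ℝ → ℂ}
    (hg : Integrable g) (hf : Integrable f) :
    convForm (dyadicKernel N R c) g f = ∫ a : ℝ × ℝ, dyadicSymbol N c a.2 *
      (planeFourier g (cubicShear a) * planeFourier f (-cubicShear a))
      ∂((volume.restrict (Set.Ioc (-R) R)).prod volume) := by
  simp_rw [convForm, dyadicKernel_eq_integral N hR, planeFourier_mul_planeFourier_neg]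
  refine integral_mul_integral_swap (h := fun a : ℝ × ℝ => dyadicSymbol N c a.2)
    (F := fun w : (ℝ × ℝ) × (ℝ × ℝ) => g w.1 * f w.2)
    (e := fun a (w : (ℝ × ℝ) × (ℝ × ℝ)) => planeChar (cubicShear a) (w.1 - w.2)) ?_ (hg.mul_prod hf) ?_
    fun a w => (norm_planeChar _ _).le
  · exact (integrable_dyadicSymbol N c).comp_snd _
  · have := continuous_cubicShear
    exact (continuous_planeChar.comp (by fun_prop : Continuous
        fun v : (ℝ × ℝ) × ((ℝ × ℝ) × (ℝ × ℝ)) => (cubicShear v.1, v.2.1 - v.2.2))).measurable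

/-- The `L²` bound when the weights have size `scale`. -/
lemma enorm_convForm_dyadicKernel_le {N : ℕ} {R : ℝ} (hR : 0 ≤ R) {c : ℕ → ℂ}
    (hc : ∀ j, ‖c j‖ ≤ scale N j) {g f : ℝ × ℝ → ℂ} (hgm : Measurable g) (hg : Integrable g)
    (hfm : Measurable f) (hf : Integrable f) :
    ‖convForm (dyadicKernel N R c) g f‖ₑ ≤ ENNReal.ofReal (20 * Real.pi ^ 2) *
      ((∫⁻ p, ‖g p‖ₑ ^ 2) ^ (1 / 2 : ℝ) * (∫⁻ p, ‖f p‖ₑ ^ 2) ^ (1 / 2 : ℝ)) := by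
  have hG := continuous_planeFourier hg
  have hF := continuous_planeFourier hf
  set B := ENNReal.ofReal (4 * Real.pi ^ 2) with hB
  have hsym : ∀ τ, ‖dyadicSymbol N c τ‖ₑ ≤ 5 := fun τ => by
    rw [← ofReal_norm]
    refine (ENNReal.ofReal_le_ofReal (norm_dyadicSymbol_le hc τ)).trans (by simp)
  rw [convForm_dyadicKernel N hR c hg hf]
  calc _ ≤ ∫⁻ a : ℝ × ℝ, ‖dyadicSymbol N c a.2 *
      (planeFourier g (cubicShear a) * planeFourier f (-cubicShear a))‖ₑ
      ∂((volume.restrict (Set.Ioc (-R) R)).prod volume) := enorm_integral_le_lintegral_enorm _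
    _ ≤ ∫⁻ a : ℝ × ℝ, 5 * (‖planeFourier g (cubicShear a)‖ₑ * ‖planeFourier f (-cubicShear a)‖ₑ)
      ∂((volume.restrict (Set.Ioc (-R) R)).prod volume) := by
        refine lintegral_mono fun a => ?_
        rw [enorm_mul, enorm_mul]
        exact mul_le_mul' (hsym _) le_rfl
    _ ≤ ∫⁻ a : ℝ × ℝ, 5 * (‖planeFourier g (cubicShear a)‖ₑ * ‖planeFourier f (-cubicShear a)‖ₑ) := by
        have hr : (volume.restrict (Set.Ioc (-R) R)).prod (volume : Measure ℝ) =
            volume.restrict (Set.Ioc (-R) R ×ˢ Set.univ) := by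
          rw [Measure.volume_eq_prod, ← Measure.prod_restrict, Measure.restrict_univ]
        rw [hr]
        exact setLIntegral_le_lintegral _ _
    _ = 5 * ∫⁻ a : ℝ × ℝ, ‖planeFourier g a‖ₑ * ‖planeFourier f (-a)‖ₑ := by
        rw [lintegral_cubicShear (h := fun a => 5 * (‖planeFourier g a‖ₑ * ‖planeFourier f (-a)‖ₑ))
          (by fun_prop), lintegral_const_mul _ (by fun_prop)]
    _ ≤ 5 * ((∫⁻ a : ℝ × ℝ, ‖planeFourier g a‖ₑ ^ (2 : ℝ)) ^ (1 / 2 : ℝ) *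
          (∫⁻ a : ℝ × ℝ, ‖planeFourier f (-a)‖ₑ ^ (2 : ℝ)) ^ (1 / 2 : ℝ)) := by
        gcongr
        exact ENNReal.lintegral_mul_le_Lp_mul_Lq _ Real.HolderConjugate.two_two (by fun_prop) (by fun_prop)
    _ ≤ 5 * ((B * ∫⁻ p, ‖g p‖ₑ ^ 2) ^ (1 / 2 : ℝ) * (B * ∫⁻ p, ‖f p‖ₑ ^ 2) ^ (1 / 2 : ℝ)) := by
        simp_rw [ENNReal.rpow_two]
        have e : ∫⁻ a : ℝ × ℝ, ‖planeFourier f (-a)‖ₑ ^ 2 = ∫⁻ a : ℝ × ℝ, ‖planeFourier f a‖ₑ ^ 2 :=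
          lintegral_neg_eq_self (fun a => ‖planeFourier f a‖ₑ ^ 2)
        rw [e]
        gcongr
        · exact lintegral_planeFourier_sq_le hgm hg
        · exact lintegral_planeFourier_sq_le hfm hf
    _ = _ := by
        have hBB : B ^ (1 / 2 : ℝ) * B ^ (1 / 2 : ℝ) = B := by
          rw [← ENNReal.rpow_add_of_nonneg _ _ (by norm_num) (by norm_num)]; norm_num
        rw [ENNReal.mul_rpow_of_nonneg _ _ (by norm_num), ENNReal.mul_rpow_of_nonneg _ _ (by norm_num),
          show (20 : ℝ) * Real.pi ^ 2 = 5 * (4 * Real.pi ^ 2) by ring, ENNReal.ofReal_mul (by norm_num),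
          ← hB, ENNReal.ofReal_ofNat]
        nth_rw 3 [← hBB]
        ring

/-- The analytic family `a ↦ (a / |a|) |a| ^ (8/7 (1 - z/2))`. -/
noncomputable def steinPow (z a : ℂ) : ℂ := a / ‖a‖ * (‖a‖ : ℂ) ^ (8 / 7 * (1 - z / 2))

@[simp] lemma steinPow_zero (z : ℂ) : steinPow z 0 = 0 := by simp [steinPow]

lemma norm_steinPow {z a : ℂ} (ha : a ≠ 0) :
    ‖steinPow z a‖ = ‖a‖ ^ (8 / 7 * (1 - z.re / 2)) := by
  have h : 0 < ‖a‖ := norm_pos_iff.2 ha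
  have e : (8 / 7 * (1 - z / 2) : ℂ).re = 8 / 7 * (1 - z.re / 2) := by
    simp [show (8 / 7 * (1 - z / 2) : ℂ) = ((8 / 7 : ℝ) : ℂ) * (1 - z / 2) by push_cast; ring,
      -Complex.ofReal_div]
  rw [steinPow, norm_mul, norm_div, Complex.norm_real, norm_norm, div_self h.ne', one_mul,
    Complex.norm_cpow_eq_rpow_re_of_pos h, e]

lemma norm_steinPow_of_re_eq_zero {z : ℂ} (hz : z.re = 0) (a : ℂ) :
    ‖steinPow z a‖ = ‖a‖ ^ (8 / 7 : ℝ) := by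
  rcases eq_or_ne a 0 with rfl | ha
  · simp
  · rw [norm_steinPow ha, hz]; norm_num

lemma norm_sq_steinPow_of_re_eq_one {z : ℂ} (hz : z.re = 1) (a : ℂ) :
    ‖steinPow z a‖ ^ 2 = ‖a‖ ^ (8 / 7 : ℝ) := by
  rcases eq_or_ne a 0 with rfl | ha
  · simp
  · rw [norm_steinPow ha, hz, ← Real.rpow_natCast, ← Real.rpow_mul (norm_nonneg _)]; norm_num

lemma steinPow_one_fourth (a : ℂ) : steinPow (1 / 4) a = a := by
  rcases eq_or_ne a 0 with rfl | ha
  · simp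
  · have h : (‖a‖ : ℂ) ≠ 0 := by simpa using ha
    rw [steinPow, show (8 / 7 * (1 - 1 / 4 / 2) : ℂ) = 1 by norm_num, Complex.cpow_one,
      div_mul_cancel₀ _ h]

lemma differentiable_steinPow (a : ℂ) : Differentiable ℂ fun z => steinPow z a := by
  rcases eq_or_ne a 0 with rfl | ha
  · simp
  · have h : (‖a‖ : ℂ) ≠ 0 := by simpa using ha
    intro z
    unfold steinPow
    exact (DifferentiableAt.const_cpow (by fun_prop) (Or.inl h)).const_mul _

/-- The analytic family of dyadic weights. -/
noncomputable def steinWeight (N : ℕ) (z : ℂ) (j : ℕ) : ℂ := (scale N j : ℂ) ^ (-(1 / 3) + 4 / 3 * z)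

lemma norm_steinWeight (N : ℕ) (z : ℂ) (j : ℕ) :
    ‖steinWeight N z j‖ = scale N j ^ (-(1 / 3) + 4 / 3 * z.re) := by
  have e : (-(1 / 3) + 4 / 3 * z : ℂ).re = -(1 / 3) + 4 / 3 * z.re := by
    rw [show (-(1 / 3) + 4 / 3 * z : ℂ) = ((-(1 / 3) : ℝ) : ℂ) + ((4 / 3 : ℝ) : ℂ) * z by push_cast; ring,
      Complex.add_re, Complex.re_ofReal_mul, Complex.ofReal_re]
  rw [steinWeight, Complex.norm_cpow_eq_rpow_re_of_pos (scale_pos N j), e]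

lemma steinWeight_one_fourth (N j : ℕ) : steinWeight N (1 / 4) j = 1 := by
  rw [steinWeight, show (-(1 / 3) + 4 / 3 * (1 / 4) : ℂ) = 0 by norm_num, Complex.cpow_zero]

lemma differentiable_steinWeight (N j : ℕ) : Differentiable ℂ fun z => steinWeight N z j := by
  have h : (scale N j : ℂ) ≠ 0 := by exact_mod_cast (scale_pos N j).ne'
  intro z
  unfold steinWeight
  exact DifferentiableAt.const_cpow (by fun_prop) (Or.inl h)

lemma norm_steinPow_eq_ofReal_re (z a : ℂ) : ‖steinPow z a‖ = ‖steinPow (z.re : ℂ) a‖ := by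
  rcases eq_or_ne a 0 with rfl | ha
  · simp
  · rw [norm_steinPow ha, norm_steinPow ha, Complex.ofReal_re]

lemma norm_steinWeight_eq_ofReal_re (N : ℕ) (z : ℂ) (j : ℕ) :
    ‖steinWeight N z j‖ = ‖steinWeight N (z.re : ℂ) j‖ := by
  rw [norm_steinWeight, norm_steinWeight, Complex.ofReal_re]

/-- The analytic family of forms interpolating between the `L¹` and `L²` bounds. -/
noncomputable def steinForm (N : ℕ) (R : ℝ) (g f : SimpleFunc (ℝ × ℝ) ℂ) (z : ℂ) : ℂ :=
  convForm (dyadicKernel N R (steinWeight N z)) (fun p => steinPow z (g p)) (fun p => steinPow z (f p))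

lemma steinForm_eq_sum (N : ℕ) {R : ℝ} (hR : 0 ≤ R) {g f : SimpleFunc (ℝ × ℝ) ℂ}
    (hg : g.FinMeasSupp volume) (hf : f.FinMeasSupp volume) :
    ∃ (S : Finset (ℂ × ℂ)) (D : ℂ × ℂ → ℕ → ℂ), ∀ z, steinForm N R g f z =
      ∑ v ∈ S, ∑ j ∈ Finset.range (2 * N),
        steinPow z v.1 * steinPow z v.2 * steinWeight N z j * D v j := by
  set h : SimpleFunc ((ℝ × ℝ) × (ℝ × ℝ)) (ℂ × ℂ) :=
    (g.comp Prod.fst measurable_fst).pair (f.comp Prod.snd measurable_snd) with hh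
  set k : ℕ → (ℝ × ℝ) × (ℝ × ℝ) → ℂ := fun j w =>
    (psi (scale N j * (w.1 - w.2).2) : ℂ) * airyKernel R (w.1 - w.2).2 (w.1 - w.2).1 with hk
  have hkc : ∀ j, Continuous (k j) := fun j => by
    have h1 := continuous_psi
    have h2 : Continuous fun w : (ℝ × ℝ) × (ℝ × ℝ) => airyKernel R (w.1 - w.2).2 (w.1 - w.2).1 :=
      (continuous_airyKernel R).comp (by fun_prop : Continuous fun w : (ℝ × ℝ) × (ℝ × ℝ) =>
        ((w.1 - w.2).2, (w.1 - w.2).1))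
    simp only [hk]
    fun_prop
  have hkb : ∀ j w, ‖k j w‖ ≤ 2 * (2 * R) := fun j w => by
    simp only [hk]
    rw [norm_mul, Complex.norm_real, Real.norm_eq_abs]
    refine mul_le_mul ?_ (norm_airyKernel_le _ _ _ hR) (norm_nonneg _) (by norm_num)
    unfold psi
    have h1 := abs_le.1 (abs_phi_le_one (scale N j * (w.1 - w.2).2))
    have h2 := abs_le.1 (abs_phi_le_one (2 * (scale N j * (w.1 - w.2).2)))
    exact abs_le.2 ⟨by linarith, by linarith⟩
  refine ⟨h.range, fun v j => ∫ w, (h ⁻¹' {v}).indicator (k j) w, fun z => ?_⟩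
  have hpt : ∀ w : (ℝ × ℝ) × (ℝ × ℝ), steinPow z (g w.1) * steinPow z (f w.2) *
      dyadicKernel N R (steinWeight N z) (w.1 - w.2) =
      ∑ v ∈ h.range, ∑ j ∈ Finset.range (2 * N), steinPow z v.1 * steinPow z v.2 * steinWeight N z j *
        (h ⁻¹' {v}).indicator (k j) w := fun w => by
    rw [Finset.sum_eq_single (h w)]
    · have hw : w ∈ h ⁻¹' {h w} := rfl
      simp only [Set.indicator_of_mem hw]
      rw [dyadicKernel, Finset.mul_sum]
      refine Finset.sum_congr rfl fun j _ => ?_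
      simp only [hh, hk, SimpleFunc.pair_apply, SimpleFunc.coe_comp, Function.comp_apply]
      ring
    · intro v _ hv
      have hw : w ∉ h ⁻¹' {v} := fun hw => hv (by simpa using hw.symm)
      simp [Set.indicator_of_notMem hw]
    · intro hw
      exact absurd (SimpleFunc.mem_range_self h w) hw
  have hInt : ∀ v j, Integrable fun w => steinPow z v.1 * steinPow z v.2 * steinWeight N z j *
        (h ⁻¹' {v}).indicator (k j) w := fun v j => by
    rcases eq_or_ne v.1 0 with h1 | h1
    · simp [h1]
    rcases eq_or_ne v.2 0 with h2 | h2
    · simp [h2]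
    refine Integrable.const_mul ?_ _
    rw [integrable_indicator_iff (h.measurableSet_fiber v)]
    refine Measure.integrableOn_of_bounded (M := 2 * (2 * R)) ?_ (hkc j).aestronglyMeasurable
      (Filter.Eventually.of_forall (hkb j))
    have hs : h ⁻¹' {v} ⊆ (g ⁻¹' {v.1}) ×ˢ (f ⁻¹' {v.2}) := by
      intro w hw
      have : h w = v := hw
      rw [← this]
      exact ⟨rfl, rfl⟩
    refine ((measure_mono hs).trans_lt ?_).ne
    rw [Measure.volume_eq_prod (ℝ × ℝ), Measure.prod_prod]
    exact ENNReal.mul_lt_top (hg.meas_preimage_singleton_ne_zero h1) (hf.meas_preimage_singleton_ne_zero h2)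
  rw [steinForm, convForm]
  simp_rw [hpt]
  rw [integral_finsetSum _ fun v _ => integrable_finsetSum _ fun j _ => hInt v j]
  refine Finset.sum_congr rfl fun v _ => ?_
  rw [integral_finsetSum _ fun j _ => hInt v j]
  exact Finset.sum_congr rfl fun j _ => integral_const_mul _ _

lemma differentiable_steinForm (N : ℕ) {R : ℝ} (hR : 0 ≤ R) {g f : SimpleFunc (ℝ × ℝ) ℂ}
    (hg : g.FinMeasSupp volume) (hf : f.FinMeasSupp volume) : Differentiable ℂ (steinForm N R g f) := by
  obtain ⟨S, D, h⟩ := steinForm_eq_sum N hR hg hf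
  rw [funext h]
  have h1 := differentiable_steinPow
  have h2 := differentiable_steinWeight N
  fun_prop

lemma bddAbove_steinForm (N : ℕ) {R : ℝ} (hR : 0 ≤ R) {g f : SimpleFunc (ℝ × ℝ) ℂ}
    (hg : g.FinMeasSupp volume) (hf : f.FinMeasSupp volume) :
    BddAbove ((norm ∘ steinForm N R g f) '' Complex.HadamardThreeLines.verticalClosedStrip 0 1) := by
  obtain ⟨S, D, h⟩ := steinForm_eq_sum N hR hg hf
  set G : ℝ → ℝ := fun x => ∑ v ∈ S, ∑ j ∈ Finset.range (2 * N),
    ‖steinPow x v.1‖ * ‖steinPow x v.2‖ * ‖steinWeight N x j‖ * ‖D v j‖ with hG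
  have hGc : Continuous G := by
    have h1 : ∀ a, Continuous fun x : ℝ => steinPow x a := fun a =>
      (differentiable_steinPow a).continuous.comp Complex.continuous_ofReal
    have h2 : ∀ j, Continuous fun x : ℝ => steinWeight N x j := fun j =>
      (differentiable_steinWeight N j).continuous.comp Complex.continuous_ofReal
    simp only [hG]
    fun_prop
  obtain ⟨M, hM⟩ := (isCompact_Icc (a := (0:ℝ)) (b := 1)).bddAbove_image hGc.continuousOn
  refine ⟨M, ?_⟩
  rintro _ ⟨z, hz, rfl⟩
  refine le_trans ?_ (hM (Set.mem_image_of_mem G (show z.re ∈ Set.Icc (0:ℝ) 1 from hz)))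
  simp only [Function.comp_apply, h, hG]
  refine (norm_sum_le _ _).trans (Finset.sum_le_sum fun v _ => (norm_sum_le _ _).trans
    (Finset.sum_le_sum fun j _ => ?_))
  rw [norm_mul, norm_mul, norm_mul, norm_steinPow_eq_ofReal_re z, norm_steinPow_eq_ofReal_re z,
    norm_steinWeight_eq_ofReal_re]

lemma lintegral_enorm_sq_steinPow {z : ℂ} (hz : z.re = 1) {f : SimpleFunc (ℝ × ℝ) ℂ}
    (hf : f.FinMeasSupp volume) :
    ∫⁻ p, ‖steinPow z (f p)‖ₑ ^ 2 = ENNReal.ofReal (∫ p, ‖f p‖ ^ (8 / 7 : ℝ)) := by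
  have hi : Integrable fun p => ‖f p‖ ^ (8 / 7 : ℝ) :=
    (hf.map (g := fun a : ℂ => ‖a‖ ^ (8 / 7 : ℝ)) (by simp)).integrable
  rw [ofReal_integral_eq_lintegral_ofReal hi (Filter.Eventually.of_forall fun p => by positivity)]
  refine lintegral_congr fun p => ?_
  rw [← norm_sq_steinPow_of_re_eq_one hz, ENNReal.ofReal_pow (norm_nonneg _), ofReal_norm]

/-- The `L^{8/7} × L^{8/7}` bound for simple functions, by complex interpolation. -/
lemma norm_convForm_simpleFunc_le (N : ℕ) {R : ℝ} (hR : 0 ≤ R) {g f : SimpleFunc (ℝ × ℝ) ℂ}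
    (hg : g.FinMeasSupp volume) (hf : f.FinMeasSupp volume) :
    ‖convForm (dyadicKernel N R fun _ => 1) g f‖ ≤
      360 * ((∫ p, ‖g p‖ ^ (8 / 7 : ℝ)) * ∫ p, ‖f p‖ ^ (8 / 7 : ℝ)) ^ (7 / 8 : ℝ) := by
  set A := ∫ p, ‖g p‖ ^ (8 / 7 : ℝ) with hA
  set B := ∫ p, ‖f p‖ ^ (8 / 7 : ℝ) with hB
  have hA0 : 0 ≤ A := integral_nonneg fun p => by positivity
  have hB0 : 0 ≤ B := integral_nonneg fun p => by positivity
  have hInt : ∀ (u : SimpleFunc (ℝ × ℝ) ℂ), u.FinMeasSupp volume → ∀ z,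
      Integrable fun p => steinPow z (u p) := fun u hu z =>
    (hu.map (g := steinPow z) (steinPow_zero z)).integrable
  have hmeas : ∀ (u : SimpleFunc (ℝ × ℝ) ℂ) (z : ℂ), Measurable fun p => steinPow z (u p) := fun u z =>
    (u.map (steinPow z)).measurable
  have h0 : ∀ z ∈ Complex.re ⁻¹' {0}, ‖steinForm N R g f z‖ ≤ 360 * (A * B) := fun z hz => by
    have hz : z.re = 0 := hz
    refine (norm_convForm_le (fun p => norm_dyadicKernel_le hR (fun j => ?_) p)
      (hInt g hg z) (hInt f hf z)).trans (le_of_eq ?_)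
    · rw [norm_steinWeight, hz]; norm_num
    · simp_rw [norm_steinPow_of_re_eq_zero hz]; rfl
  have h1 : ∀ z ∈ Complex.re ⁻¹' {1}, ‖steinForm N R g f z‖ ≤ 360 * (A * B) ^ (1 / 2 : ℝ) := fun z hz => by
    have hz : z.re = 1 := hz
    have h := enorm_convForm_dyadicKernel_le (N := N) hR (c := steinWeight N z) (fun j => by
      rw [norm_steinWeight, hz]; norm_num) (hmeas g z) (hInt g hg z) (hmeas f z) (hInt f hf z)
    rw [lintegral_enorm_sq_steinPow hz hg, lintegral_enorm_sq_steinPow hz hf,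
      ENNReal.ofReal_rpow_of_nonneg hA0 (by norm_num), ENNReal.ofReal_rpow_of_nonneg hB0 (by norm_num),
      ← ENNReal.ofReal_mul (by positivity), ← ENNReal.ofReal_mul (by positivity), ← ofReal_norm,
      ENNReal.ofReal_le_ofReal_iff (by positivity), ← Real.mul_rpow hA0 hB0] at h
    refine h.trans ?_
    gcongr
    nlinarith [Real.pi_lt_four, Real.pi_pos]
  have key := Complex.HadamardThreeLines.norm_le_interp_of_mem_verticalClosedStrip₀₁' (steinForm N R g f)
    (z := 1 / 4) (by constructor <;> norm_num) (differentiable_steinForm N hR hg hf).diffContOnCl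
    (bddAbove_steinForm N hR hg hf) h0 h1
  have e : steinForm N R g f (1 / 4) = convForm (dyadicKernel N R fun _ => 1) g f := by
    simp only [steinForm, steinPow_one_fourth]
    congr 2
    exact funext fun j => steinWeight_one_fourth N j
  rw [e] at key
  refine key.trans (le_of_eq ?_)
  have hAB : 0 ≤ A * B := mul_nonneg hA0 hB0
  generalize A * B = P at hAB
  rw [show (1 / 4 : ℂ).re = 1 / 4 by norm_num, Real.mul_rpow (by norm_num) hAB,
    Real.mul_rpow (by norm_num) (by positivity), ← Real.rpow_mul hAB, mul_mul_mul_comm,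
    ← Real.rpow_add (by norm_num), ← Real.rpow_add_of_nonneg hAB (by norm_num) (by norm_num)]
  norm_num

lemma dyadicKernel_one (N : ℕ) (R : ℝ) (p : ℝ × ℝ) : dyadicKernel N R (fun _ => 1) p =
    ((phi (p.2 / 2 ^ N) - phi (2 ^ N * p.2) : ℝ) : ℂ) * airyKernel R p.2 p.1 := by
  rw [dyadicKernel, ← sum_psi_scale, Complex.ofReal_sum, Finset.sum_mul]
  simp

lemma norm_dyadicKernel_one_le (N : ℕ) {R : ℝ} (hR : 0 ≤ R) (p : ℝ × ℝ) :
    ‖dyadicKernel N R (fun _ => 1) p‖ ≤ 2 * (2 * R) := by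
  rw [dyadicKernel_one, norm_mul, Complex.norm_real, Real.norm_eq_abs]
  refine mul_le_mul ?_ (norm_airyKernel_le _ _ _ hR) (norm_nonneg _) (by norm_num)
  have h1 := abs_le.1 (abs_phi_le_one (p.2 / 2 ^ N))
  have h2 := abs_le.1 (abs_phi_le_one (2 ^ N * p.2))
  exact abs_le.2 ⟨by linarith, by linarith⟩

/-- The bound of `norm_convForm_simpleFunc_le` for general functions. -/
lemma norm_convForm_le_rpow (N : ℕ) {R : ℝ} (hR : 0 ≤ R) {g f : ℝ × ℝ → ℂ}
    (hgm : Measurable g) (hg : Integrable g) (hg' : Integrable fun p => ‖g p‖ ^ (8 / 7 : ℝ))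
    (hfm : Measurable f) (hf : Integrable f) (hf' : Integrable fun p => ‖f p‖ ^ (8 / 7 : ℝ)) :
    ‖convForm (dyadicKernel N R fun _ => 1) g f‖ ≤
      360 * ((∫ p, ‖g p‖ ^ (8 / 7 : ℝ)) * ∫ p, ‖f p‖ ^ (8 / 7 : ℝ)) ^ (7 / 8 : ℝ) := by
  set s : ∀ u : ℝ × ℝ → ℂ, Measurable u → ℕ → SimpleFunc (ℝ × ℝ) ℂ := fun _ hu n =>
    SimpleFunc.approxOn _ hu Set.univ 0 (Set.mem_univ 0) n
  have hle : ∀ {u : ℝ × ℝ → ℂ} (hu : Measurable u) n p, ‖s _ hu n p‖ ≤ 2 * ‖u p‖ := fun hu n p => by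
    rw [two_mul]; exact SimpleFunc.norm_approxOn_zero_le hu (Set.mem_univ 0) p n
  have hlim : ∀ {u : ℝ × ℝ → ℂ} (hu : Measurable u) p,
      Filter.Tendsto (fun n => s _ hu n p) Filter.atTop (nhds (u p)) := fun hu p =>
    SimpleFunc.tendsto_approxOn hu (Set.mem_univ 0) (by simp)
  have hfin : ∀ {u : ℝ × ℝ → ℂ} (hu : Measurable u), Integrable u → ∀ n,
      (s _ hu n).FinMeasSupp volume := fun hu hi n =>
    SimpleFunc.integrable_iff_finMeasSupp.1 ((hi.norm.const_mul 2).mono'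
      (s _ hu n).measurable.aestronglyMeasurable (Filter.Eventually.of_forall (hle hu n)))
  have hpow : ∀ {u : ℝ × ℝ → ℂ} (hu : Measurable u), Integrable (fun p => ‖u p‖ ^ (8 / 7 : ℝ)) →
      Filter.Tendsto (fun n => ∫ p, ‖s _ hu n p‖ ^ (8 / 7 : ℝ)) Filter.atTop
        (nhds (∫ p, ‖u p‖ ^ (8 / 7 : ℝ))) := fun {u} hu hi => by
    refine tendsto_integral_of_dominated_convergence (fun p => 2 ^ (8 / 7 : ℝ) * ‖u p‖ ^ (8 / 7 : ℝ))
      (fun n => ((s _ hu n).measurable.norm.pow_const _).aestronglyMeasurable) (hi.const_mul _) (fun n => ?_) ?_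
    · refine Filter.Eventually.of_forall fun p => ?_
      rw [Real.norm_eq_abs, abs_of_nonneg (by positivity), ← Real.mul_rpow (by norm_num) (norm_nonneg _)]
      exact Real.rpow_le_rpow (norm_nonneg _) (hle hu n p) (by norm_num)
    · exact Filter.Eventually.of_forall fun p =>
        (hlim hu p).norm.rpow_const (Or.inr (by norm_num))
  have hK := continuous_dyadicKernel N R fun _ => 1
  have hform : Filter.Tendsto (fun n => convForm (dyadicKernel N R fun _ => 1) (s _ hgm n) (s _ hfm n))
      Filter.atTop (nhds (convForm (dyadicKernel N R fun _ => 1) g f)) := by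
    refine tendsto_integral_of_dominated_convergence
      (fun w : (ℝ × ℝ) × (ℝ × ℝ) => ((2 * ‖g w.1‖) * (2 * ‖f w.2‖)) * (2 * (2 * R))) (fun n => ?_) ?_
      (fun n => ?_) ?_
    · have h1 := (s _ hgm n).measurable
      have h2 := (s _ hfm n).measurable
      have h3 := hK.measurable
      exact Measurable.aestronglyMeasurable (by fun_prop)
    · exact ((hg.norm.const_mul 2).mul_prod (hf.norm.const_mul 2)).mul_const _
    · refine Filter.Eventually.of_forall fun w => ?_
      rw [norm_mul, norm_mul]
      gcongr
      · exact hle hgm n _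
      · exact hle hfm n _
      · exact norm_dyadicKernel_one_le N hR _
    · exact Filter.Eventually.of_forall fun w => ((hlim hgm _).mul (hlim hfm _)).mul_const _
  exact le_of_tendsto_of_tendsto' hform.norm
    ((((hpow hgm hg').mul (hpow hfm hf')).rpow_const (Or.inr (by norm_num))).const_mul 360)
    fun n => norm_convForm_simpleFunc_le N hR (hfin hgm hg n) (hfin hfm hf n)

/-- The regularized inhomogeneous evolution. -/
noncomputable def truncEvol (N : ℕ) (f : ℝ × ℝ → ℂ) (p : ℝ × ℝ) : ℂ :=
  ∫ q, f q * dyadicKernel N N (fun _ => 1) (p - q)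

lemma measurable_truncEvol (N : ℕ) {f : ℝ × ℝ → ℂ} (hfm : Measurable f) : Measurable (truncEvol N f) := by
  have hK := (continuous_dyadicKernel N N fun _ => 1).measurable
  refine (StronglyMeasurable.integral_prod_right
    (f := fun p q => f q * dyadicKernel N N (fun _ => 1) (p - q)) (Measurable.stronglyMeasurable ?_)).measurable
  simp only [Function.uncurry_def]
  fun_prop

lemma norm_truncEvol_le (N : ℕ) {f : ℝ × ℝ → ℂ} (hf : Integrable f) (p : ℝ × ℝ) :
    ‖truncEvol N f p‖ ≤ (∫ q, ‖f q‖) * (2 * (2 * N)) := by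
  rw [← integral_mul_const]
  refine norm_integral_le_of_norm_le (hf.norm.mul_const _) (Filter.Eventually.of_forall fun q => ?_)
  rw [norm_mul]
  exact mul_le_mul_of_nonneg_left (norm_dyadicKernel_one_le N (Nat.cast_nonneg N) _) (norm_nonneg _)

/-- The uniform `L^{8/7} → L^8` bound for the regularized evolution on a set of finite measure. -/
lemma lintegral_truncEvol_le (N : ℕ) {f : ℝ × ℝ → ℂ} (hfm : Measurable f) (hf : Integrable f)
    (hf' : Integrable fun p => ‖f p‖ ^ (8 / 7 : ℝ)) {s : Set (ℝ × ℝ)} (hs : MeasurableSet s)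
    (hs' : volume s < ⊤) :
    ∫⁻ p in s, ‖truncEvol N f p‖ₑ ^ 8 ≤
      ENNReal.ofReal (360 ^ 8 * (∫ p, ‖f p‖ ^ (8 / 7 : ℝ)) ^ 7) := by
  set u := truncEvol N f with hu
  set B := ∫ p, ‖f p‖ ^ (8 / 7 : ℝ) with hB
  set M := (∫ q, ‖f q‖) * (2 * (2 * N)) with hM
  have hB0 : 0 ≤ B := integral_nonneg fun p => by positivity
  have hum : Measurable u := measurable_truncEvol N hfm
  have hub : ∀ p, ‖u p‖ ≤ M := norm_truncEvol_le N hf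
  have bdd : ∀ {v : ℝ × ℝ → ℂ} {C : ℝ}, Measurable v → (∀ p, ‖v p‖ ≤ C) → Integrable (s.indicator v) :=
    fun hv hC => (integrable_indicator_iff hs).2 (Measure.integrableOn_of_bounded hs'.ne
      hv.aestronglyMeasurable (Filter.Eventually.of_forall hC))
  set g : ℝ × ℝ → ℂ := s.indicator fun p => starRingEnd ℂ (u p) * (‖u p‖ : ℂ) ^ 6 with hg
  have hg0m : Measurable fun p => starRingEnd ℂ (u p) * (‖u p‖ : ℂ) ^ 6 := by
    have : Measurable fun p => starRingEnd ℂ (u p) := Complex.continuous_conj.measurable.comp hum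
    fun_prop
  have hgm : Measurable g := hg0m.indicator hs
  have hgi : Integrable g := bdd hg0m (C := M * M ^ 6) fun p => by
    rw [norm_mul, RCLike.norm_conj, norm_pow, Complex.norm_real, norm_norm]
    have := hub p
    have := norm_nonneg (u p)
    gcongr
  have hpow : ∀ p, ‖g p‖ ^ (8 / 7 : ℝ) = s.indicator (fun p => ‖u p‖ ^ 8) p := fun p => by
    by_cases hp : p ∈ s
    · rw [hg, Set.indicator_of_mem hp, Set.indicator_of_mem hp, norm_mul, RCLike.norm_conj, norm_pow,
        Complex.norm_real, norm_norm, ← pow_succ', ← Real.rpow_natCast, ← Real.rpow_mul (norm_nonneg _),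
        ← Real.rpow_natCast]
      norm_num
    · rw [hg, Set.indicator_of_notMem hp, Set.indicator_of_notMem hp, norm_zero, Real.zero_rpow (by norm_num)]
  have hi8 : IntegrableOn (fun p => ‖u p‖ ^ 8) s := by
    refine Measure.integrableOn_of_bounded (M := M ^ 8) hs'.ne (by fun_prop)
      (Filter.Eventually.of_forall fun p => ?_)
    rw [norm_pow, norm_norm]
    exact pow_le_pow_left₀ (norm_nonneg _) (hub p) 8
  have hgi' : Integrable fun p => ‖g p‖ ^ (8 / 7 : ℝ) := by
    simp_rw [hpow]
    exact (integrable_indicator_iff hs).2 hi8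
  set J := ∫ p in s, ‖u p‖ ^ 8 with hJ
  have hJ0 : 0 ≤ J := integral_nonneg fun p => by positivity
  have hgJ : ∫ p, ‖g p‖ ^ (8 / 7 : ℝ) = J := by
    simp_rw [hpow]
    exact integral_indicator hs
  have hform : convForm (dyadicKernel N N fun _ => 1) g f = (J : ℂ) := by
    have hK := (continuous_dyadicKernel N N fun _ => 1).measurable
    rw [convForm, Measure.volume_eq_prod (ℝ × ℝ), integral_prod]
    · simp only [mul_assoc, integral_const_mul]
      rw [hJ, ← integral_complex_ofReal, ← integral_indicator hs]
      refine integral_congr_ae (Filter.Eventually.of_forall fun p => ?_)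
      change g p * u p = _
      by_cases hp : p ∈ s
      · rw [hg, Set.indicator_of_mem hp, Set.indicator_of_mem hp, mul_right_comm, Complex.conj_mul']
        push_cast; ring
      · rw [hg, Set.indicator_of_notMem hp, Set.indicator_of_notMem hp, zero_mul]
    · exact (hgi.mul_prod hf).mul_bdd (c := 2 * (2 * N))
        (Measurable.aestronglyMeasurable (by fun_prop))
        (Filter.Eventually.of_forall fun w => norm_dyadicKernel_one_le N (Nat.cast_nonneg N) _)
  have key := norm_convForm_le_rpow N (Nat.cast_nonneg N) hgm hgi hgi' hfm hf hf'
  rw [hform, hgJ, Complex.norm_real, Real.norm_eq_abs, abs_of_nonneg hJ0] at key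
  have hle : J ≤ 360 ^ 8 * B ^ 7 := by
    rcases hJ0.eq_or_lt with h | h
    · rw [← h]; positivity
    have h8 := pow_le_pow_left₀ hJ0 key 8
    rw [mul_pow, ← Real.rpow_natCast (_ ^ (7 / 8 : ℝ)), ← Real.rpow_mul (by positivity),
      show (7 / 8 : ℝ) * ((8 : ℕ) : ℝ) = ((7 : ℕ) : ℝ) by norm_num, Real.rpow_natCast, mul_pow] at h8
    have h7 : 0 < J ^ 7 := by positivity
    refine le_of_mul_le_mul_left (le_of_eq_of_le ?_ (h8.trans_eq ?_)) h7 <;> ring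
  have e : ∫⁻ p in s, ‖u p‖ₑ ^ 8 = ENNReal.ofReal J := by
    rw [hJ, ofReal_integral_eq_lintegral_ofReal hi8 (Filter.Eventually.of_forall fun p => by positivity)]
    refine lintegral_congr fun p => ?_
    rw [ENNReal.ofReal_pow (norm_nonneg _), ofReal_norm]
  rw [e]
  exact ENNReal.ofReal_le_ofReal hle

/-- The restriction of a Schwartz function on the plane to a horizontal line. -/
noncomputable def schwartzSlice (f : SchwartzMap (ℝ × ℝ) ℂ) (s : ℝ) : SchwartzMap ℝ ℂ :=
  SchwartzMap.compCLM ℂ (g := fun x : ℝ => (x, s))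
    (by
      have h := (ContinuousLinearMap.inl ℝ ℝ ℝ).hasTemperateGrowth.add
        (Function.HasTemperateGrowth.const ((0 : ℝ), s))
      convert h using 1
      ext x <;> simp)
    ⟨1, 1, fun x => by
      rw [pow_one, one_mul]
      exact (le_max_left ‖x‖ ‖s‖).trans (le_add_of_nonneg_left zero_le_one)⟩ f

open scoped FourierTransform in
lemma integrable_fhat_schwartz (v : SchwartzMap ℝ ℂ) : Integrable (fhat v) := by
  have h : Integrable (𝓕 v : SchwartzMap ℝ ℂ) := SchwartzMap.integrable _
  have h2 := h.comp_div (show (2 * Real.pi : ℝ) ≠ 0 by positivity)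
  refine h2.congr (Filter.Eventually.of_forall fun ξ => ?_)
  simp only [SchwartzMap.fourier_coe]
  rw [Real.fourier_real_eq_integral_exp_smul, fhat]
  refine integral_congr_ae (Filter.Eventually.of_forall fun y => ?_)
  simp only [smul_eq_mul]
  congr 2
  have : (Real.pi : ℂ) ≠ 0 := by exact_mod_cast Real.pi_ne_zero
  push_cast
  field_simp

lemma exists_schwartz_bound (f : SchwartzMap (ℝ × ℝ) ℂ) :
    ∃ C, 0 ≤ C ∧ ∀ y s : ℝ, ‖f (y, s)‖ ≤ C * ((1 + y ^ 2)⁻¹ * (1 + s ^ 2)⁻¹) := by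
  refine ⟨2 ^ 4 * (Finset.Iic ((4, 0) : ℕ × ℕ)).sup (fun m => SchwartzMap.seminorm ℝ m.1 m.2) f,
    mul_nonneg (by norm_num) (apply_nonneg _ _), fun y s => ?_⟩
  · have h := SchwartzMap.one_add_le_sup_seminorm_apply (𝕜 := ℝ) (m := (4, 0)) (k := 4) (n := 0) le_rfl le_rfl
      f (y, s)
    rw [norm_iteratedFDeriv_zero] at h
    rw [← mul_inv, ← div_eq_mul_inv, le_div_iff₀ (by positivity), mul_comm]
    refine le_trans ?_ h
    gcongr
    have h1 : |y| ≤ ‖(y, s)‖ := le_max_left ‖y‖ ‖s‖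
    have h2 : |s| ≤ ‖(y, s)‖ := le_max_right ‖y‖ ‖s‖
    have e : ∀ r : ℝ, |r| ≤ ‖(y, s)‖ → 1 + r ^ 2 ≤ (1 + ‖(y, s)‖) ^ 2 := fun r hr => by
      rw [← sq_abs r]
      nlinarith [abs_nonneg r]
    calc (1 + y ^ 2) * (1 + s ^ 2) ≤ (1 + ‖(y, s)‖) ^ 2 * (1 + ‖(y, s)‖) ^ 2 :=
          mul_le_mul (e y h1) (e s h2) (by positivity) (by positivity)
      _ = _ := by ring

lemma integrable_abs_sub_rpow_mul (t : ℝ) :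
    Integrable fun s : ℝ => |t - s| ^ (-(1 / 3 : ℝ)) * (1 + s ^ 2)⁻¹ := by
  have h1 : IntegrableOn (fun r : ℝ => |r| ^ (-(1 / 3 : ℝ))) (Set.Icc (-1) 1) := by
    have hp : IntegrableOn (fun r : ℝ => |r| ^ (-(1 / 3 : ℝ))) (Set.Ioc 0 1) := by
      have h := (intervalIntegral.intervalIntegrable_rpow' (a := 0) (b := 1)
        (r := -(1 / 3 : ℝ)) (by norm_num)).1
      exact h.congr_fun (fun r hr => by simp only; rw [abs_of_pos hr.1]) measurableSet_Ioc
    have hn : IntegrableOn (fun r : ℝ => |r| ^ (-(1 / 3 : ℝ))) (Set.Ico (-1) 0) := by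
      have h := (Measure.measurePreserving_neg (volume : Measure ℝ)).integrableOn_comp_preimage
        (Homeomorph.neg ℝ).measurableEmbedding (f := fun r : ℝ => |r| ^ (-(1 / 3 : ℝ))) (s := Set.Ioc 0 1)
      have h' := h.2 hp
      simpa [Function.comp_def] using h'
    have h0 : IntegrableOn (fun r : ℝ => |r| ^ (-(1 / 3 : ℝ))) {0} :=
      integrableOn_singleton (by simp) (by simp)
    refine ((hn.union h0).union hp).mono_set fun r hr => ?_
    rcases lt_trichotomy r 0 with h | h | h
    · exact Or.inl (Or.inl ⟨hr.1, h⟩)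
    · exact Or.inl (Or.inr h)
    · exact Or.inr ⟨h, hr.2⟩
  have h2 : Integrable fun s => (Set.Icc (-1 : ℝ) 1).indicator (fun r : ℝ => |r| ^ (-(1 / 3 : ℝ))) (t - s) :=
    ((integrable_indicator_iff measurableSet_Icc).2 h1).comp_sub_left t
  refine (h2.add integrable_inv_one_add_sq).mono' (by
    refine Measurable.aestronglyMeasurable ?_; fun_prop) (Filter.Eventually.of_forall fun s => ?_)
  have hs : (1 + s ^ 2)⁻¹ ≤ 1 := inv_le_one_of_one_le₀ (by nlinarith [sq_nonneg s])
  have hs0 : 0 < (1 + s ^ 2)⁻¹ := by positivity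
  have hr0 : 0 ≤ |t - s| ^ (-(1 / 3 : ℝ)) := by positivity
  rw [Real.norm_eq_abs, abs_of_nonneg (by positivity)]
  simp only [Pi.add_apply]
  by_cases hr : t - s ∈ Set.Icc (-1 : ℝ) 1
  · rw [Set.indicator_of_mem hr]
    nlinarith
  · rw [Set.indicator_of_notMem hr, zero_add]
    refine mul_le_of_le_one_left hs0.le (Real.rpow_le_one_of_one_le_of_nonpos ?_ (by norm_num))
    by_contra h
    exact hr (abs_le.1 (not_le.1 h).le)

lemma tendsto_phi_sub_phi {r : ℝ} (hr : r ≠ 0) :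
    Filter.Tendsto (fun N : ℕ => phi (r / 2 ^ N) - phi (2 ^ N * r)) Filter.atTop (nhds 1) := by
  have hq : Filter.Tendsto (fun N : ℕ => ((1 / 2 : ℝ)) ^ N) Filter.atTop (nhds 0) :=
    tendsto_pow_atTop_nhds_zero_of_lt_one (by norm_num) (by norm_num)
  have h1 : Filter.Tendsto (fun N : ℕ => phi (r / 2 ^ N)) Filter.atTop (nhds 1) := by
    have h := (continuous_phi.tendsto (r * 0)).comp (hq.const_mul r)
    have h0 : phi (r * 0) = 1 := by simp [phi]
    rw [h0] at h
    refine h.congr fun N => ?_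
    simp [div_eq_mul_inv]
  have h2 : Filter.Tendsto (fun N : ℕ => phi (2 ^ N * r)) Filter.atTop (nhds 0) := by
    have hq2 : Filter.Tendsto (fun N : ℕ => 1 / r ^ 2 * ((1 / 2 : ℝ) ^ N) ^ 2) Filter.atTop (nhds 0) := by
      have h := (hq.pow 2).const_mul (1 / r ^ 2)
      rwa [zero_pow two_ne_zero, mul_zero] at h
    refine squeeze_zero_norm (fun N => ?_) hq2
    have hb : ∀ x : ℝ, x ≠ 0 → |phi x| ≤ 1 / x ^ 2 := fun x hx => by
      have hx2 : 0 < x ^ 2 := by positivity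
      unfold phi
      rw [abs_div, abs_of_pos (by positivity : 0 < (1 + x ^ 2) ^ 2), div_le_div_iff₀ (by positivity) hx2, one_mul]
      rcases abs_cases (1 - x ^ 2) with ⟨h, _⟩ | ⟨h, _⟩ <;> rw [h] <;> nlinarith
    rw [Real.norm_eq_abs]
    refine (hb _ (by positivity)).trans (le_of_eq ?_)
    rw [div_pow, div_pow, one_pow, one_pow]
    field_simp
  simpa using h1.sub h2

lemma integral_mul_airyKernel {v : ℝ → ℂ} (hv : Integrable v) {R : ℝ} (hR : 0 ≤ R) (t x : ℝ) :
    ∫ y, v y * airyKernel R t (x - y) = ∫ ξ in (-R)..R, airyExp t x ξ * fhat v ξ := by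
  have h := integral_mul_integral_swap (μ := volume.restrict (Set.Ioc (-R) R)) (ν := volume)
    (h := fun _ => 1) (F := v) (e := fun ξ y => airyExp t (x - y) ξ)
    (integrable_const _) hv ?_ fun ξ y => (norm_airyExp _ _ _).le
  · simp only [one_mul] at h
    simp_rw [airyKernel, intervalIntegral.integral_of_le (by linarith : -R ≤ R)]
    rw [h]
    refine integral_congr_ae (Filter.Eventually.of_forall fun ξ => ?_)
    simp only [fhat]
    rw [← integral_const_mul]
    refine integral_congr_ae (Filter.Eventually.of_forall fun y => ?_)
    simp only [airyExp]
    rw [← mul_assoc, ← Complex.exp_add, mul_comm (v y)]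
    congr 2
    push_cast; ring
  · exact (continuous_airyExp.comp (by fun_prop : Continuous fun w : ℝ × ℝ => ((t, x - w.2), w.1))).measurable

lemma tendsto_integral_airyExp {v : ℝ → ℂ} (hv : Integrable (fhat v)) (t x : ℝ) :
    Filter.Tendsto (fun N : ℕ => ∫ ξ in (-(N:ℝ))..N, airyExp t x ξ * fhat v ξ) Filter.atTop
      (nhds (U t v x)) := by
  have hi : Integrable fun ξ => airyExp t x ξ * fhat v ξ := by
    have := integrable_mul_of_norm_le_one hv (continuous_airyExp_right t x).aestronglyMeasurable
      fun ξ => (norm_airyExp t x ξ).le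
    simpa only [mul_comm] using this
  exact intervalIntegral_tendsto_integral hi
    (Filter.tendsto_neg_atTop_atBot.comp tendsto_natCast_atTop_atTop) tendsto_natCast_atTop_atTop

lemma truncEvol_eq (N : ℕ) (f : SchwartzMap (ℝ × ℝ) ℂ) (p : ℝ × ℝ) :
    truncEvol N f p = ∫ s : ℝ, ((phi ((p.2 - s) / 2 ^ N) - phi (2 ^ N * (p.2 - s)) : ℝ) : ℂ) *
      ∫ y : ℝ, f (y, s) * airyKernel N (p.2 - s) (p.1 - y) := by
  have hK := continuous_dyadicKernel N N fun _ => 1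
  rw [truncEvol, Measure.volume_eq_prod, integral_prod_symm]
  · refine integral_congr_ae (Filter.Eventually.of_forall fun s => ?_)
    simp only [dyadicKernel_one, Prod.fst_sub, Prod.snd_sub]
    rw [← integral_const_mul]
    refine integral_congr_ae (Filter.Eventually.of_forall fun y => ?_)
    simp only
    ring
  · exact f.integrable.mul_bdd (c := 2 * (2 * N)) (by fun_prop)
      (Filter.Eventually.of_forall fun w => norm_dyadicKernel_one_le N (Nat.cast_nonneg N) _)

lemma tendsto_truncEvol (f : SchwartzMap (ℝ × ℝ) ℂ) (p : ℝ × ℝ) :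
    Filter.Tendsto (fun N : ℕ => truncEvol N f p) Filter.atTop
      (nhds (∫ s : ℝ, U (p.2 - s) (fun x => f (x, s)) p.1)) := by
  obtain ⟨C, hC0, hC⟩ := exists_schwartz_bound f
  have hne : ∀ᵐ s : ℝ, s ≠ p.2 := by simp [ae_iff]
  have hslice : ∀ s, Integrable fun y => f (y, s) := fun s => (schwartzSlice f s).integrable
  simp_rw [truncEvol_eq]
  refine tendsto_integral_of_dominated_convergence
    (fun s => 24 * C * Real.pi * (|p.2 - s| ^ (-(1 / 3 : ℝ)) * (1 + s ^ 2)⁻¹)) (fun N => ?_)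
    ((integrable_abs_sub_rpow_mul p.2).const_mul _) (fun N => ?_) ?_
  · have h1 := continuous_phi.measurable
    have h2 := continuous_airyKernel N
    have h3 := f.continuous
    have h4 : Measurable fun s : ℝ => ∫ y : ℝ, f (y, s) * airyKernel N (p.2 - s) (p.1 - y) := by
      refine (StronglyMeasurable.integral_prod_right
        (f := fun s y : ℝ => f (y, s) * airyKernel N (p.2 - s) (p.1 - y)) (Continuous.stronglyMeasurable ?_)).measurable
      simp only [Function.uncurry_def]
      exact (h3.comp continuous_swap).mul (h2.comp (by fun_prop : Continuous fun w : ℝ × ℝ =>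
        (p.2 - w.1, p.1 - w.2)))
    exact Measurable.aestronglyMeasurable (by fun_prop)
  · filter_upwards [hne] with s hs
    have ht : p.2 - s ≠ 0 := sub_ne_zero.2 hs.symm
    have hL : ‖∫ y : ℝ, f (y, s) * airyKernel N (p.2 - s) (p.1 - y)‖ ≤
        12 * C * Real.pi * (|p.2 - s| ^ (-(1 / 3 : ℝ)) * (1 + s ^ 2)⁻¹) := by
      have hb := norm_integral_le_of_norm_le (μ := (volume : Measure ℝ))
        (f := fun y => f (y, s) * airyKernel N (p.2 - s) (p.1 - y))
        (integrable_inv_one_add_sq.mul_const (C * (1 + s ^ 2)⁻¹ * (12 * |p.2 - s| ^ (-(1 / 3 : ℝ)))))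
        (Filter.Eventually.of_forall fun y => by
          rw [norm_mul]
          calc _ ≤ C * ((1 + y ^ 2)⁻¹ * (1 + s ^ 2)⁻¹) * (12 * |p.2 - s| ^ (-(1 / 3 : ℝ))) :=
                mul_le_mul (hC y s) (norm_airyKernel_le_rpow ht _ (Nat.cast_nonneg N)) (norm_nonneg _)
                  (by positivity)
            _ = _ := by ring)
      rw [integral_mul_const, integral_univ_inv_one_add_sq] at hb
      refine hb.trans (le_of_eq (by ring))
    rw [norm_mul, Complex.norm_real, Real.norm_eq_abs]
    have h1 := abs_le.1 (abs_phi_le_one ((p.2 - s) / 2 ^ N))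
    have h2 := abs_le.1 (abs_phi_le_one (2 ^ N * (p.2 - s)))
    have h3 : |phi ((p.2 - s) / 2 ^ N) - phi (2 ^ N * (p.2 - s))| ≤ 2 :=
      abs_le.2 ⟨by linarith, by linarith⟩
    refine (mul_le_mul h3 hL (norm_nonneg _) (by norm_num)).trans (le_of_eq (by ring))
  · filter_upwards [hne] with s hs
    have ht : p.2 - s ≠ 0 := sub_ne_zero.2 hs.symm
    have h1 := (Complex.continuous_ofReal.tendsto 1).comp (tendsto_phi_sub_phi ht)
    have h2 := tendsto_integral_airyExp (integrable_fhat_schwartz (schwartzSlice f s)) (p.2 - s) p.1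
    have h3 := h1.mul h2
    rw [Complex.ofReal_one, one_mul] at h3
    refine h3.congr fun N => ?_
    rw [integral_mul_airyKernel (hslice s) (Nat.cast_nonneg N)]
    rfl

/-- The inhomogeneous Strichartz estimate, in integral form. -/
lemma lintegral_evol_le (f : SchwartzMap (ℝ × ℝ) ℂ) :
    ∫⁻ p : ℝ × ℝ, ‖∫ s : ℝ, U (p.2 - s) (fun x => f (x, s)) p.1‖ₑ ^ 8 ≤
      ENNReal.ofReal (360 ^ 8 * (∫ p, ‖f p‖ ^ (8 / 7 : ℝ)) ^ 7) := by
  have hf' : Integrable fun p => ‖f p‖ ^ (8 / 7 : ℝ) := by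
    have h := (f.memLp (8 / 7)).integrable_norm_rpow (by simp)
      (ENNReal.div_ne_top (by simp) (by simp))
    simpa using h
  have hfm : Measurable f := f.continuous.measurable
  set s : ℕ → Set (ℝ × ℝ) := fun N => Metric.closedBall 0 N
  have hs : ∀ N, MeasurableSet (s N) := fun N => Metric.isClosed_closedBall.measurableSet
  have hlim : ∀ p : ℝ × ℝ, Filter.Tendsto
      (fun N : ℕ => (s N).indicator (fun p => ‖truncEvol N f p‖ₑ ^ 8) p) Filter.atTop
      (nhds (‖∫ s : ℝ, U (p.2 - s) (fun x => f (x, s)) p.1‖ₑ ^ 8)) := fun p => by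
    have h := ENNReal.Tendsto.pow (n := 8) (tendsto_truncEvol f p).enorm
    refine h.congr' ?_
    filter_upwards [Filter.eventually_ge_atTop ⌈‖p‖⌉₊] with N hN
    have hp : p ∈ s N := by
      rw [mem_closedBall_zero_iff]
      exact Nat.ceil_le.1 hN
    rw [Set.indicator_of_mem hp]
  simp_rw [← fun p => (hlim p).liminf_eq]
  refine (lintegral_liminf_le fun N =>
    ((measurable_truncEvol N hfm).enorm.pow_const 8).indicator (hs N)).trans ?_
  refine Filter.liminf_le_of_le (by isBoundedDefault) fun c hc => ?_
  obtain ⟨N, hN⟩ := hc.exists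
  refine hN.trans ?_
  rw [lintegral_indicator (hs N)]
  exact lintegral_truncEvol_le N hfm f.integrable hf' (hs N) measure_closedBall_lt_top

theorem stmt7 : ∃ c : ℝ, 0 < c ∧ ∀ f : SchwartzMap (ℝ × ℝ) ℂ,
    eLpNorm (fun p : ℝ × ℝ => ∫ t' : ℝ, U (p.2 - t') (fun x => f (x, t')) p.1) 8 volume ≤
      ENNReal.ofReal c * eLpNorm (fun p : ℝ × ℝ => f p) (8/7) volume := by
  refine ⟨360, by norm_num, fun f => ?_⟩
  have h87 : (8 / 7 : ENNReal) ≠ ⊤ := ENNReal.div_ne_top (by simp) (by simp)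
  have hf' : Integrable fun p => ‖f p‖ ^ (8 / 7 : ℝ) := by
    simpa using (f.memLp (8 / 7)).integrable_norm_rpow (by simp) h87
  have hB0 : 0 ≤ ∫ p, ‖f p‖ ^ (8 / 7 : ℝ) := integral_nonneg fun p => by positivity
  have e : ∫⁻ p, ‖f p‖ₑ ^ (8 / 7 : ℝ) = ENNReal.ofReal (∫ p, ‖f p‖ ^ (8 / 7 : ℝ)) := by
    rw [ofReal_integral_eq_lintegral_ofReal hf' (Filter.Eventually.of_forall fun p => by positivity)]
    refine lintegral_congr fun p => ?_
    rw [← ENNReal.ofReal_rpow_of_nonneg (norm_nonneg _) (by norm_num), ofReal_norm]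
  rw [eLpNorm_eq_lintegral_rpow_enorm_toReal (by simp) (by simp),
    eLpNorm_eq_lintegral_rpow_enorm_toReal (by simp) h87, ENNReal.toReal_div, ENNReal.toReal_ofNat,
    ENNReal.toReal_ofNat, e]
  have key := lintegral_evol_le f
  generalize ∫ p, ‖f p‖ ^ (8 / 7 : ℝ) = B at hB0 key
  calc _ ≤ ENNReal.ofReal (360 ^ 8 * B ^ 7) ^ (1 / 8 : ℝ) := by
        refine ENNReal.rpow_le_rpow (le_of_eq_of_le (lintegral_congr fun p => ?_) key) (by norm_num)
        rw [← ENNReal.rpow_natCast]; norm_num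
    _ = _ := by
        rw [ENNReal.ofReal_rpow_of_nonneg (by positivity) (by norm_num),
          ENNReal.ofReal_rpow_of_nonneg hB0 (by norm_num), ← ENNReal.ofReal_mul (by norm_num),
          Real.mul_rpow (by positivity) (by positivity), ← Real.rpow_natCast B, ← Real.rpow_mul hB0,
          ← Real.rpow_natCast 360, ← Real.rpow_mul (by norm_num)]
        norm_num
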